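/- arXiv:2004.13302 — 2 statements merged into one kernel-verified Lean document; each statement's English description precedes it below -/
import Mathlib

section
/- Let k ≥ 1 and let θ be the constant threshold weighting θ ≡ 1 + 1/k on the path P_k (with k+1 vertices and k edges). For every join-tree A over P_k whose graph equals P_k, Φ_θ(A|∅) ≥ log_{√5+5}(k) − 1, where Φ_θ(·|·) is the two-parameter potential function over (P_k, θ). -/
open scoped Classical

noncomputable section

namespace Paper

/-- A join-tree: a finite rooted binary tree whose leaves are labeled by
edges (elements of `Sym2 α`) or by `⊥` (here `none`). -/
inductive JoinTree (α : Type*) where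
  | leaf : Option (Sym2 α) → JoinTree α
  | node : JoinTree α → JoinTree α → JoinTree α

variable {V : Type*}

/-- The vertex set of a finite edge set (a finite subgraph given by its edges). -/
def vset (F : Finset (Sym2 V)) : Set V := {v | ∃ e ∈ F, v ∈ e}

lemma vset_mono {F F' : Finset (Sym2 V)} (h : F ⊆ F') : vset F ⊆ vset F' := by
  rintro v ⟨e, he, hv⟩
  exact ⟨e, h he, hv⟩

/-- `Δ_θ(F) = |V(F)| − Σ_{e ∈ E(F)} θ(e)`. -/
def Delta (θ : Sym2 V → ℝ) (F : Finset (Sym2 V)) : ℝ :=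
  ((vset F).ncard : ℝ) - ∑ e ∈ F, θ e

/-- `θ` is a threshold weighting on the graph with edge set `E`:
it takes values in `[0,2]` on `E`, `Δ_θ(F) ≥ 0` for every finite subgraph `F ⊆ E`,
and `Δ_θ(E) = 0` whenever `E` is finite. -/
def IsThresholdWeighting (E : Set (Sym2 V)) (θ : Sym2 V → ℝ) : Prop :=
  (∀ e ∈ E, 0 ≤ θ e ∧ θ e ≤ 2) ∧
  (∀ F : Finset (Sym2 V), (F : Set (Sym2 V)) ⊆ E → 0 ≤ Delta θ F) ∧
  (∀ hE : E.Finite, Delta θ hE.toFinset = 0)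

/-- `F ⊖ S`: the union of the connected components of `F` that are vertex-disjoint
from `S`. -/
def elimS (F : Finset (Sym2 V)) (S : Set V) : Finset (Sym2 V) :=
  F.filter fun e =>
    ∀ v ∈ e, ∀ s ∈ S, ¬ (SimpleGraph.fromEdgeSet (F : Set (Sym2 V))).Reachable v s

/-- The graph with edge set `F` is connected. -/
def ConnE (F : Finset (Sym2 V)) : Prop :=
  ∀ u ∈ vset F, ∀ w ∈ vset F, (SimpleGraph.fromEdgeSet (F : Set (Sym2 V))).Reachable u w

/-- The subgraph of `F` induced on a vertex set `T`. -/
def induced (F : Finset (Sym2 V)) (T : Set V) : Finset (Sym2 V) :=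
  F.filter fun e => ∀ v ∈ e, v ∈ T

namespace JoinTree

/-- The graph of a join-tree: the finite subgraph whose edges are the labels
occurring in the tree. -/
def graph : JoinTree V → Finset (Sym2 V)
  | leaf none => ∅
  | leaf (some e) => {e}
  | node B C => graph B ∪ graph C

/-- `Sub D A` means `D ⪯ A`: `D = ⟨⟩`, or `D = A`, or `D` is a sub-join-tree of a
child of `A`. -/
inductive Sub : JoinTree V → JoinTree V → Prop
  | empty (A : JoinTree V) : Sub (leaf none) A
  | refl (A : JoinTree V) : Sub A A
  | left {D B C : JoinTree V} : Sub D B → Sub D (node B C)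
  | right {D B C : JoinTree V} : Sub D C → Sub D (node B C)

/-- `SubP D A` means `D ≺ A`, i.e. `D ⪯ A` and `D ≠ A`. -/
def SubP (D A : JoinTree V) : Prop := Sub D A ∧ D ≠ A

/-- A join-tree is atomic if it is a single (labeled or unlabeled) leaf. -/
def Atomic (A : JoinTree V) : Prop := ∃ l, A = leaf l

/-- Replace every leaf label not belonging to `E'` by `⊥`. -/
def prune : JoinTree V → Finset (Sym2 V) → JoinTree V
  | leaf none, _ => leaf none
  | leaf (some e), E' => if e ∈ E' then leaf (some e) else leaf none
  | node B C, E' => node (prune B E') (prune C E')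

/-- `A ⊖ S`: delete all leaf labels except those belonging to `Gr(A) ⊖ S`. -/
def elimT (A : JoinTree V) (S : Set V) : JoinTree V := prune A (Paper.elimS A.graph S)

/-- `A` is a join-tree over the graph with edge set `E` (all labels come from `E`). -/
def Over (E : Set (Sym2 V)) (A : JoinTree V) : Prop := (A.graph : Set (Sym2 V)) ⊆ E

lemma graph_mono_of_sub {D A : JoinTree V} (h : Sub D A) : D.graph ⊆ A.graph := by
  induction h with
  | empty A => intro e he; simp [graph] at he
  | refl A => exact Finset.Subset.refl _
  | left _ ih => exact ih.trans Finset.subset_union_left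
  | right _ ih => exact ih.trans Finset.subset_union_right

end JoinTree

open JoinTree

/-- The constraints defining the two-parameter potential function `Φ_θ(A|S)`:
nonnegativity, the atomic base case, inequalities (†) and (inverted †) (in both
orders of the children) and inequality (‡). -/
def Phi2Ok (E : Set (Sym2 V)) (θ : Sym2 V → ℝ) (g : JoinTree V → Set V → ℝ) : Prop :=
  (∀ (A : JoinTree V) (S : Set V), Over E A → 0 ≤ g A S) ∧
  (∀ (A : JoinTree V) (S : Set V), Over E A → Atomic A →
      Delta θ (elimS A.graph S) ≤ g A S) ∧
  (∀ (B C : JoinTree V) (S : Set V), Over E (JoinTree.node B C) →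
      g B S + Delta θ (elimS C.graph (S ∪ vset B.graph)) ≤ g (JoinTree.node B C) S) ∧
  (∀ (B C : JoinTree V) (S : Set V), Over E (JoinTree.node B C) →
      g C S + Delta θ (elimS B.graph (S ∪ vset C.graph)) ≤ g (JoinTree.node B C) S) ∧
  (∀ (B C : JoinTree V) (S : Set V), Over E (JoinTree.node B C) →
      Delta θ (elimS B.graph S) + g C (S ∪ vset B.graph) ≤ g (JoinTree.node B C) S) ∧
  (∀ (B C : JoinTree V) (S : Set V), Over E (JoinTree.node B C) →
      Delta θ (elimS C.graph S) + g B (S ∪ vset C.graph) ≤ g (JoinTree.node B C) S) ∧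
  (∀ (A D : JoinTree V) (S : Set V), Over E A → SubP D A → ¬ (vset D.graph ⊆ S) →
      (g D S + g A (S ∪ vset D.graph) + Delta θ (elimS A.graph S)) / 2 ≤ g A S)

/-- The two-parameter potential function `Φ_θ(A|S)`: the pointwise smallest
function satisfying the constraints `Phi2Ok`. -/
def Phi2 (E : Set (Sym2 V)) (θ : Sym2 V → ℝ) (A : JoinTree V) (S : Set V) : ℝ :=
  sInf { y | ∃ g : JoinTree V → Set V → ℝ, Phi2Ok E θ g ∧ y = g A S }

/-- The edge set of the two-way infinite path `P_∞` on vertex set `ℤ`. -/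
def EPinf : Set (Sym2 ℤ) := { e | ∃ i : ℤ, e = s(i, i + 1) }

/-- The constant threshold weighting `θ ≡ 1` on `P_∞`. -/
def theta1 : Sym2 ℤ → ℝ := fun _ => 1

/-- `P_{i,j} ⊆ F`: all edges of the path from `i` to `j` belong to `F`. -/
def pathIn (F : Finset (Sym2 ℤ)) (i j : ℤ) : Prop :=
  ∀ m : ℤ, i ≤ m → m < j → s(m, m + 1) ∈ F

/-- `(i,j)` is an open component of `F|S`. -/
def OpenComp (F : Finset (Sym2 ℤ)) (S : Set ℤ) (i j : ℤ) : Prop :=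
  i < j ∧ pathIn F i j ∧ ∀ m : ℤ, i ≤ m → m ≤ j → (m ∈ S ↔ m = i ∨ m = j)

/-- `[i,j)` is a half-open component of `F|S`. -/
def HOLComp (F : Finset (Sym2 ℤ)) (S : Set ℤ) (i j : ℤ) : Prop :=
  i < j ∧ pathIn F i j ∧ (∀ m : ℤ, i ≤ m → m ≤ j → (m ∈ S ↔ m = i)) ∧ s(j, j + 1) ∉ F

/-- `(i,j]` is a half-open component of `F|S`. -/
def HORComp (F : Finset (Sym2 ℤ)) (S : Set ℤ) (i j : ℤ) : Prop :=
  i < j ∧ pathIn F i j ∧ (∀ m : ℤ, i ≤ m → m ≤ j → (m ∈ S ↔ m = j)) ∧ s(i - 1, i) ∉ F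

/-- `[i,j]` is a closed component of `F|S`. -/
def ClosedComp (F : Finset (Sym2 ℤ)) (S : Set ℤ) (i j : ℤ) : Prop :=
  i < j ∧ pathIn F i j ∧ (∀ m : ℤ, i ≤ m → m ≤ j → m ∉ S) ∧
    s(i - 1, i) ∉ F ∧ s(j, j + 1) ∉ F

/-- The number of closed components of `F|S`. -/
def closedCount (F : Finset (Sym2 ℤ)) (S : Set ℤ) : ℕ :=
  {p : ℤ × ℤ | ClosedComp F S p.1 p.2}.ncard

/-- `λ(F)`: the number of edges of the largest connected component of `F`
(the length of the longest path in a subgraph of `P_∞`). -/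
def lamP (F : Finset (Sym2 ℤ)) : ℕ :=
  sSup { m | ∃ v ∈ vset F,
    m = (F.filter fun e =>
      ∃ u ∈ e, (SimpleGraph.fromEdgeSet (F : Set (Sym2 ℤ))).Reachable u v).card }

/-- The edge set of the path `P_k` with vertices `0, 1, …, k`. -/
def PkF (k : ℕ) : Finset (Sym2 ℤ) :=
  (Finset.range k).image fun i => s((i : ℤ), (i : ℤ) + 1)

theorem exists_run_start (B : Set ℤ) {p e : ℤ} (hpe : p ≤ e) (he : e ∈ B) :
    ∃ i, p ≤ i ∧ i ≤ e ∧ (∀ m, i ≤ m → m ≤ e → m ∈ B) ∧ (i = p ∨ i - 1 ∉ B) := by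
  induction e, hpe using Int.leInduction with
  | base => exact ⟨p, le_rfl, le_rfl, fun m h1 h2 => by rwa [le_antisymm h2 h1], Or.inl rfl⟩
  | succ e hpe ih =>
    by_cases h : e ∈ B
    · obtain ⟨i, h1, h2, h3, h4⟩ := ih h
      refine ⟨i, h1, by omega, fun m hm hm' => ?_, h4⟩
      rcases eq_or_lt_of_le hm' with rfl | hlt
      · exact he
      · exact h3 m hm (by omega)
    · refine ⟨e + 1, by omega, le_rfl, fun m h1 h2 => by rwa [le_antisymm h2 h1], Or.inr ?_⟩
      simpa using h

theorem exists_run_end (B : Set ℤ) {q e : ℤ} (heq : e < q) (he : e ∈ B) :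
    ∃ j, e < j ∧ j ≤ q ∧ (∀ m, e ≤ m → m < j → m ∈ B) ∧ (j = q ∨ j ∉ B) := by
  obtain ⟨i, h1, h2, h3, h4⟩ := exists_run_start (Neg.neg ⁻¹' B) (p := 1 - q) (e := -e)
    (by omega) (by simpa using he)
  refine ⟨1 - i, by omega, by omega, fun m hm hm' => ?_, ?_⟩
  · simpa using h3 (-m) (by omega) (by omega)
  · rcases h4 with h | h
    · left; omega
    · right; simpa using h

/-- Length bound for an interval `[p, q]` cut into maximal runs of `B` and gaps between them,
where `X` collects the runs that are counted. -/
theorem length_le_of_runs (B : Set ℤ) {p q : ℤ} (X : Set (ℤ × ℤ)) (hX : X.Finite)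
    {a t g α : ℝ} (hc : 0 ≤ g + α)
    (hrun : ∀ i j : ℤ, p < i → i < j → j < q → (∀ m, i ≤ m → m < j → m ∈ B) → i - 1 ∉ B → j ∉ B →
      (i, j) ∈ X ∧ (j - i : ℝ) ≤ α)
    (hgap : ∀ i j : ℤ, p < i → i < j → j < q → (∀ m, i ≤ m → m < j → m ∉ B) → i - 1 ∈ B → j ∈ B →
      (j - i : ℝ) ≤ g)
    (hrun₀ : ∀ j : ℤ, p < j → j < q → (∀ m, p ≤ m → m < j → m ∈ B) → j ∉ B →
      (j - p : ℝ) ≤ a ∨ ((p, j) ∈ X ∧ (j - p : ℝ) ≤ a + g + α))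
    (hgap₀ : ∀ j : ℤ, p < j → j < q → (∀ m, p ≤ m → m < j → m ∉ B) → j ∈ B →
      (j - p : ℝ) ≤ a + g)
    (hrun₁ : ∀ i : ℤ, p < i → i < q → (∀ m, i ≤ m → m < q → m ∈ B) → i - 1 ∉ B →
      (q - i : ℝ) ≤ t - g ∨ ((i, q) ∈ X ∧ (q - i : ℝ) ≤ t + α))
    (hgap₁ : ∀ i : ℤ, p < i → i < q → (∀ m, i ≤ m → m < q → m ∉ B) → i - 1 ∈ B →
      (q - i : ℝ) ≤ t)
    (hin : ∃ m, p ≤ m ∧ m < q ∧ m ∈ B) (hout : ∃ m, p ≤ m ∧ m < q ∧ m ∉ B) :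
    (q - p : ℝ) ≤ a + t + X.ncard * (g + α) := by
  set n : ℤ → ℕ := fun x => (X ∩ {z | z.2 ≤ x}).ncard with hn
  have hfin : ∀ x, (X ∩ {z | z.2 ≤ x}).Finite := fun x => hX.inter_of_left _
  have n_le : ∀ x, n x ≤ X.ncard := fun x => Set.ncard_le_ncard Set.inter_subset_left hX
  have n_succ : ∀ i x y : ℤ, (i, x) ∈ X → y < x → n y + 1 ≤ n x := by
    intro i x y hix hyx
    rw [hn]
    have hnot : (i, x) ∉ X ∩ {z | z.2 ≤ y} := fun h => absurd h.2 (not_le.mpr hyx)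
    rw [← Set.ncard_insert_of_notMem hnot (hfin y)]
    refine Set.ncard_le_ncard ?_ (hfin x)
    rintro z (rfl | hz)
    · exact ⟨hix, le_refl x⟩
    · exact ⟨hz.1, le_trans hz.2 hyx.le⟩
  have mulc : ∀ {u v : ℕ}, u ≤ v → (u : ℝ) * (g + α) ≤ v * (g + α) := fun h =>
    mul_le_mul_of_nonneg_right (by exact_mod_cast h) hc
  have key : ∀ d : ℕ, ∀ x : ℤ, x - p ≤ d → p < x → x < q → x - 1 ∈ B → x ∉ B →
      (x - p : ℝ) ≤ a + n x * (g + α) := by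
    intro d
    induction d with
    | zero => intro x h1 h2; omega
    | succ d ih =>
      intro x hd hpx hxq hx1 hx
      obtain ⟨i, hpi, hix, hi, hi'⟩ := exists_run_start B (by omega : p ≤ x - 1) hx1
      have hi2 : ∀ m, i ≤ m → m < x → m ∈ B := fun m h1 h2 => hi m h1 (by omega)
      by_cases hip : i = p
      · subst hip
        rcases hrun₀ x hpx hxq hi2 hx with h | ⟨h, h'⟩
        · have := mulc (Nat.zero_le (n x)); push_cast at this; linarith
        · have := mulc ((Nat.le_add_left 1 _).trans (n_succ _ _ (x - 1) h (by omega)))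
          push_cast at this; linarith
      have hi1 := hi'.resolve_left hip
      have hpi' : p < i := by omega
      obtain ⟨hmem, hlen⟩ := hrun i x hpi' (by omega) hxq hi2 hi1 hx
      obtain ⟨y, hpy, hyi, hy, hy'⟩ := exists_run_start Bᶜ (by omega : p ≤ i - 1) hi1
      have hy2 : ∀ m, y ≤ m → m < i → m ∉ B := fun m h1 h2 => hy m h1 (by omega)
      have hiB : i ∈ B := hi i le_rfl (by omega)
      by_cases hyp : y = p
      · subst hyp
        have h0 := hgap₀ i hpi' (by omega) hy2 hiB
        have := mulc ((Nat.le_add_left 1 _).trans (n_succ _ _ (x - 1) hmem (by omega)))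
        push_cast at this; linarith
      have hy1 : y - 1 ∈ B := by simpa using hy'.resolve_left hyp
      have h0 := ih y (by omega) (by omega) (by omega) hy1 (hy2 y le_rfl (by omega))
      have h1 := hgap y i (by omega) (by omega) (by omega) hy2 hy1 hiB
      have := mulc (n_succ _ _ y hmem (by omega))
      push_cast at this; linarith
  have key' : ∀ x : ℤ, p < x → x < q → x - 1 ∈ B → x ∉ B →
      (x - p : ℝ) ≤ a + n x * (g + α) := fun x h => key (x - p).toNat x (by omega) h
  have hpq : p ≤ q - 1 := by obtain ⟨m, h1, h2, -⟩ := hin; omega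
  by_cases hq : q - 1 ∈ B
  · obtain ⟨i, hpi, hix, hi, hi'⟩ := exists_run_start B hpq hq
    have hi2 : ∀ m, i ≤ m → m < q → m ∈ B := fun m h1 h2 => hi m h1 (by omega)
    have hip : i ≠ p := by
      rintro rfl; obtain ⟨m, h1, h2, h3⟩ := hout; exact h3 (hi2 m h1 h2)
    have hi1 := hi'.resolve_left hip
    have hr := hrun₁ i (by omega) (by omega) hi2 hi1
    obtain ⟨y, hpy, hyi, hy, hy'⟩ := exists_run_start Bᶜ (by omega : p ≤ i - 1) hi1
    have hy2 : ∀ m, y ≤ m → m < i → m ∉ B := fun m h1 h2 => hy m h1 (by omega)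
    have hiB : i ∈ B := hi i le_rfl (by omega)
    have hX0 := mulc (Nat.zero_le X.ncard)
    push_cast at hX0
    by_cases hyp : y = p
    · subst hyp
      have h0 := hgap₀ i (by omega) (by omega) hy2 hiB
      rcases hr with h | ⟨h, h'⟩
      · linarith
      · have := mulc (((Nat.le_add_left 1 _).trans (n_succ _ _ (q - 1) h (by omega))).trans
          (n_le _))
        push_cast at this; linarith
    have hy1 : y - 1 ∈ B := by simpa using hy'.resolve_left hyp
    have h0 := key' y (by omega) (by omega) hy1 (hy2 y le_rfl (by omega))
    have h1 := hgap y i (by omega) (by omega) (by omega) hy2 hy1 hiB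
    rcases hr with h | ⟨h, h'⟩
    · have := mulc (n_le y); linarith
    · have := mulc ((n_succ _ _ y h (by omega)).trans (n_le q))
      push_cast at this; linarith
  · obtain ⟨y, hpy, hyi, hy, hy'⟩ := exists_run_start Bᶜ hpq hq
    have hy2 : ∀ m, y ≤ m → m < q → m ∉ B := fun m h1 h2 => hy m h1 (by omega)
    have hyp : y ≠ p := by
      rintro rfl; obtain ⟨m, h1, h2, h3⟩ := hin; exact hy2 m h1 h2 h3
    have hy1 : y - 1 ∈ B := by simpa using hy'.resolve_left hyp
    have h0 := key' y (by omega) (by omega) hy1 (hy2 y le_rfl (by omega))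
    have h1 := hgap₁ y (by omega) (by omega) hy2 hy1
    have := mulc (n_le y)
    linarith

/-- The vertices incident to the edges `{m, m + 1}`, `m ∈ I`. -/
def ends (I : Set ℤ) : Set ℤ := {v | v ∈ I ∨ v - 1 ∈ I}

/-- `[i, j]` is a component, vertex-disjoint from `S`, of the graph with edges `{m, m + 1}`,
`m ∈ I`. -/
structure IsClosedRun (I S : Set ℤ) (i j : ℤ) : Prop where
  lt : i < j
  mem : ∀ m, i ≤ m → m < j → m ∈ I
  left : i - 1 ∉ I
  right : j ∉ I
  disj : ∀ m, i ≤ m → m ≤ j → m ∉ S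

/-- The components counted by `Δ(I|S)` for the constant weighting `1`. -/
def closedRuns (I S : Set ℤ) : Set (ℤ × ℤ) := {z | IsClosedRun I S z.1 z.2}

/-- The number of closed components of `I|S`. -/
def numClosed (I S : Set ℤ) : ℕ := (closedRuns I S).ncard

/-- `[p, q]` is a closed, half-open or open component of `I|S`. -/
structure IsSegment (I S : Set ℤ) (p q : ℤ) : Prop where
  lt : p < q
  mem : ∀ m, p ≤ m → m < q → m ∈ I
  interior : ∀ m, p < m → m < q → m ∉ S
  left : p ∈ S ∨ p - 1 ∉ I
  right : q ∈ S ∨ q ∉ I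

theorem closedRuns_finite {I : Set ℤ} (hI : I.Finite) (S : Set ℤ) : (closedRuns I S).Finite := by
  refine (hI.prod (hI.image (· + 1))).subset fun z hz => ⟨hz.mem _ le_rfl hz.lt, z.2 - 1, ?_, ?_⟩
  · exact hz.mem _ (by have := hz.lt; omega) (by omega)
  · simp

theorem IsClosedRun.eq {I S S' : Set ℤ} {i j i' j' e : ℤ} (h : IsClosedRun I S i j)
    (h' : IsClosedRun I S' i' j') (h1 : i ≤ e) (h2 : e < j) (h3 : i' ≤ e) (h4 : e < j') :
    i = i' ∧ j = j' := by
  constructor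
  · rcases lt_trichotomy i i' with hlt | heq | hlt
    · exact absurd (h.mem (i' - 1) (by omega) (by omega)) h'.left
    · exact heq
    · exact absurd (h'.mem (i - 1) (by omega) (by omega)) h.left
  · rcases lt_trichotomy j j' with hlt | heq | hlt
    · exact absurd (h'.mem j (by omega) (by omega)) h.right
    · exact heq
    · exact absurd (h.mem j' (by omega) (by omega)) h'.right

theorem IsSegment.isClosedRun {I S : Set ℤ} {p q : ℤ} (h : IsSegment I S p q) (hp : p ∉ S)
    (hq : q ∉ S) : IsClosedRun I S p q :=
  ⟨h.lt, h.mem, h.left.resolve_left hp, h.right.resolve_left hq, fun m h1 h2 => by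
    rcases eq_or_lt_of_le h1 with rfl | h1
    · exact hp
    rcases eq_or_lt_of_le h2 with rfl | h2
    · exact hq
    exact h.interior m h1 h2⟩

theorem IsClosedRun.isSegment {I S : Set ℤ} {p q : ℤ} (h : IsClosedRun I S p q) :
    IsSegment I S p q :=
  ⟨h.lt, h.mem, fun m h1 h2 => h.disj m h1.le h2.le, Or.inr h.left, Or.inr h.right⟩

theorem ncard_add_ncard_le {B C S : Set ℤ} (hB : B.Finite) (hC : C.Finite) {W X : Set (ℤ × ℤ)}
    (hW : W ⊆ closedRuns (B ∪ C) S) (hX : X ⊆ closedRuns B S)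
    (hWX : ∀ z ∈ W, ∀ x ∈ X, z.1 ≤ x.1 → ¬ x.2 ≤ z.2) :
    W.ncard + X.ncard ≤ numClosed B S + numClosed C (S ∪ ends B) := by
  have hWf : W.Finite := (closedRuns_finite (hB.union hC) S).subset hW
  set R := closedRuns C (S ∪ ends B) with hR
  have hex : ∀ z ∈ W \ R, ∃ x ∈ closedRuns B S, z.1 ≤ x.1 ∧ x.2 ≤ z.2 := by
    rintro ⟨i, j⟩ ⟨hz, hzR⟩
    have hz := hW hz
    by_cases hb : ∃ e, i ≤ e ∧ e < j ∧ e ∈ B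
    · obtain ⟨e, h1, h2, h3⟩ := hb
      obtain ⟨u, hu1, hu2, hu3, hu4⟩ := exists_run_start B h1 h3
      obtain ⟨v, hv1, hv2, hv3, hv4⟩ := exists_run_end B h2 h3
      refine ⟨(u, v), ⟨by dsimp; omega, fun m h1 h2 => ?_, ?_, ?_, fun m h1 h2 => ?_⟩, hu1, hv2⟩
      · by_cases hme : m ≤ e
        · exact hu3 m h1 hme
        · exact hv3 m (by omega) h2
      · rcases hu4 with rfl | h
        · exact fun h => hz.left (Or.inl h)
        · exact h
      · rcases hv4 with rfl | h
        · exact fun h => hz.right (Or.inl h)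
        · exact h
      · exact hz.disj m (hu1.trans h1) (le_trans h2 hv2)
    · push Not at hb
      refine absurd ⟨hz.lt, fun m h1 h2 => (hz.mem m h1 h2).resolve_left (hb m h1 h2),
        fun h => hz.left (Or.inr h), fun h => hz.right (Or.inr h), fun m h1 h2 => ?_⟩ hzR
      have hl := hz.left
      have hr := hz.right
      dsimp at h1 h2 hl hr
      rintro (h | h | h)
      · exact hz.disj m h1 h2 h
      · by_cases hmj : m = j
        · exact hr (Or.inl (hmj ▸ h))
        · exact hb m h1 (by omega) h
      · by_cases hmi : m = i
        · exact hl (Or.inl (hmi ▸ h))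
        · exact hb (m - 1) (by omega) (by omega) h
  choose! φ hφ using hex
  have h1 : (W \ R).ncard ≤ (closedRuns B S \ X).ncard := by
    refine Set.ncard_le_ncard_of_injOn φ (fun z hz => ⟨(hφ z hz).1, fun h => ?_⟩) ?_
      ((closedRuns_finite hB S).sdiff)
    · exact hWX z hz.1 _ h (hφ z hz).2.1 (hφ z hz).2.2
    · intro z hz z' hz' heq
      obtain ⟨h1, h2, h3⟩ := hφ z hz
      obtain ⟨-, h2', h3'⟩ := hφ z' hz'
      rw [← heq] at h2' h3'
      have := h1.lt
      have := (hW hz.1).eq (hW hz'.1) h2 (by omega) h2' (by omega)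
      exact Prod.ext this.1 this.2
  have h2 := Set.ncard_sdiff_add_ncard_of_subset hX (closedRuns_finite hB S)
  have h3 := Set.ncard_inter_add_ncard_sdiff_eq_ncard W R hWf
  have h4 : (W ∩ R).ncard ≤ R.ncard :=
    Set.ncard_le_ncard Set.inter_subset_right (closedRuns_finite hC _)
  rw [numClosed, numClosed, ← hR]
  omega

/-- The closed components of `B|S` inside `[p, q]`. -/
def runsIn (B S : Set ℤ) (p q : ℤ) : Set (ℤ × ℤ) :=
  {z | z ∈ closedRuns B S ∧ p ≤ z.1 ∧ z.2 ≤ q}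

theorem numClosed_union_le {B C : Set ℤ} (hB : B.Finite) (hC : C.Finite) (S : Set ℤ) :
    numClosed (B ∪ C) S ≤ numClosed B S + numClosed C (S ∪ ends B) := by
  simpa [numClosed] using ncard_add_ncard_le hB hC (W := closedRuns (B ∪ C) S) (X := ∅) (S := S)
    subset_rfl (Set.empty_subset _) (by simp)

theorem IsSegment.numClosed_add_le {B C S : Set ℤ} {p q : ℤ} (h : IsSegment (B ∪ C) S p q)
    (hB : B.Finite) (hC : C.Finite) (hS : p ∈ S ∨ q ∈ S) :
    numClosed (B ∪ C) S + (runsIn B S p q).ncard ≤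
      numClosed B S + numClosed C (S ∪ ends B) := by
  refine ncard_add_ncard_le hB hC subset_rfl (fun z hz => hz.1) ?_
  rintro ⟨i, j⟩ hz ⟨u, v⟩ ⟨hx, hpu, hvq⟩ hiu hvj
  have := hx.lt
  dsimp at *
  rcases hS with hS | hS
  · have : p < i := by
      by_contra hcon
      exact hz.disj p (by dsimp; omega) (by dsimp; omega) hS
    exact hz.left (h.mem _ (by dsimp; omega) (by dsimp; omega))
  · have : j < q := by
      by_contra hcon
      exact hz.disj q (by dsimp; omega) (by dsimp; omega) hS
    exact hz.right (h.mem _ (by dsimp; omega) (by dsimp; omega))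

theorem IsClosedRun.numClosed_add_le {B C S : Set ℤ} {p q : ℤ} (h : IsClosedRun (B ∪ C) S p q)
    (hB : B.Finite) (hC : C.Finite) :
    numClosed (B ∪ C) S + (runsIn B S p q).ncard ≤
      numClosed B S + numClosed C (S ∪ ends B) + 1 := by
  have h1 := ncard_add_ncard_le hB hC (W := closedRuns (B ∪ C) S \ {(p, q)})
    (X := runsIn B S p q) Set.sdiff_subset (fun z hz => hz.1) ?_
  · have h2 := Set.le_ncard_sdiff {(p, q)} (closedRuns (B ∪ C) S)
    rw [Set.ncard_singleton] at h2
    unfold numClosed at *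
    omega
  · rintro ⟨i, j⟩ ⟨hz, hne⟩ ⟨u, v⟩ ⟨hx, hpu, hvq⟩ hiu hvj
    have := hx.lt
    dsimp at *
    have := hz.eq h hiu (by dsimp; omega) hpu (by omega)
    dsimp at this
    exact hne (by simp [this])

/-- The weight of a component with end points `p`, `q`: closed, half-open or open. -/
def segWeight (S : Set ℤ) (p q : ℤ) : ℝ :=
  if p ∈ S then (if q ∈ S then 1 / 2 else 1) else (if q ∈ S then 1 else √5 - 2)

theorem segWeight_open {S : Set ℤ} {p q : ℤ} (hp : p ∈ S) (hq : q ∈ S) :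
    segWeight S p q = 1 / 2 := by simp [segWeight, hp, hq]

theorem segWeight_left {S : Set ℤ} {p q : ℤ} (hp : p ∈ S) (hq : q ∉ S) :
    segWeight S p q = 1 := by simp [segWeight, hp, hq]

theorem segWeight_right {S : Set ℤ} {p q : ℤ} (hp : p ∉ S) (hq : q ∈ S) :
    segWeight S p q = 1 := by simp [segWeight, hp, hq]

theorem segWeight_closed {S : Set ℤ} {p q : ℤ} (hp : p ∉ S) (hq : q ∉ S) :
    segWeight S p q = √5 - 2 := by simp [segWeight, hp, hq]

theorem sqrt_five_sq : √5 * √5 = 5 := Real.mul_self_sqrt (by norm_num)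

theorem sqrt_five_gt : 2.236 < √5 := Real.lt_sqrt_of_sq_lt (by norm_num)

theorem sqrt_five_lt : √5 < 2.237 := (Real.sqrt_lt' (by norm_num)).mpr (by norm_num)

theorem segWeight_le_one (S : Set ℤ) (p q : ℤ) : segWeight S p q ≤ 1 := by
  have := sqrt_five_lt
  unfold segWeight
  split_ifs <;> linarith

/-- In a component `[p, q]` of `(B ∪ C)|S`, the runs of `B` are components of `B|S` and the gaps
between them are components of `C|S ∪ V(B)`; this bounds the length of `[p, q]` in terms of
the bounds for the components of `B` and `C`. -/
theorem IsSegment.length_le {B C S : Set ℤ} {p q : ℤ} (h : IsSegment (B ∪ C) S p q)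
    (hB : B.Finite) {U a t : ℝ} (hU : 0 ≤ U)
    (hBU : ∀ i j, IsSegment B S i j → segWeight S i j * (j - i) ≤ U)
    (hCU : ∀ i j, IsSegment C (S ∪ ends B) i j → segWeight (S ∪ ends B) i j * (j - i) ≤ U)
    (ha : (p ∈ S ∧ a = U) ∨ (p ∉ S ∧ p ∈ B ∧ a = -2 * U))
    (ht : (q ∈ S ∧ t = 3 * U) ∨ (q ∉ S ∧ q - 1 ∈ B ∧ t = 0) ∨ (q ∉ S ∧ t = U))
    (hin : ∃ m, p ≤ m ∧ m < q ∧ m ∈ B) (hout : ∃ m, p ≤ m ∧ m < q ∧ m ∉ B) :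
    (q - p : ℝ) ≤ a + t + (runsIn B S p q).ncard * (U * (√5 + 4)) := by
  have h5 := sqrt_five_sq
  have h5' := sqrt_five_gt
  have hK : ∀ x : ℝ, (√5 - 2) * x ≤ U → x ≤ (√5 + 2) * U := by
    intro x hx
    nlinarith [mul_le_mul_of_nonneg_left hx (by linarith : 0 ≤ √5 + 2)]
  have hleft : p ∉ S → p - 1 ∉ B := fun hp hB => h.left.resolve_left hp (Or.inl hB)
  have hright : q ∉ S → q ∉ B := fun hp hB => h.right.resolve_left hp (Or.inl hB)
  have hleft' : p ∉ S → p - 1 ∉ C := fun hp hB => h.left.resolve_left hp (Or.inr hB)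
  have hright' : q ∉ S → q ∉ C := fun hp hB => h.right.resolve_left hp (Or.inr hB)
  have run : ∀ i j, p ≤ i → i < j → j ≤ q → (∀ m, i ≤ m → m < j → m ∈ B) →
      (i ∈ S ∨ i - 1 ∉ B) → (j ∈ S ∨ j ∉ B) → IsSegment B S i j :=
    fun i j h1 h2 h3 h4 h5 h6 =>
      ⟨h2, h4, fun m hm hm' => h.interior m (by omega) (by omega), h5, h6⟩
  have crun : ∀ i j, p ≤ i → i < j → j ≤ q → (∀ m, i ≤ m → m < j → m ∈ B) →
      i ∉ S → j ∉ S → i - 1 ∉ B → j ∉ B →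
      (i, j) ∈ runsIn B S p q ∧ (j - i : ℝ) ≤ (√5 + 2) * U := by
    intro i j h1 h2 h3 h4 h5 h6 h7 h8
    have hs := run i j h1 h2 h3 h4 (Or.inr h7) (Or.inr h8)
    refine ⟨⟨hs.isClosedRun h5 h6, h1, h3⟩, hK _ ?_⟩
    simpa only [segWeight_closed h5 h6] using hBU i j hs
  have gap : ∀ i j, p ≤ i → i < j → j ≤ q → (∀ m, i ≤ m → m < j → m ∉ B) →
      (i ∈ S ∪ ends B ∨ i - 1 ∉ C) → (j ∈ S ∪ ends B ∨ j ∉ C) →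
      IsSegment C (S ∪ ends B) i j := by
    intro i j h1 h2 h3 h4 h5 h6
    refine ⟨h2, fun m hm hm' => (h.mem m (by omega) (by omega)).resolve_left (h4 m hm hm'),
      fun m hm hm' => ?_, h5, h6⟩
    rintro (hh | hh | hh)
    · exact h.interior m (by omega) (by omega) hh
    · exact h4 m hm.le hm' hh
    · exact h4 _ (by omega) (by omega) hh
  have ogap : ∀ i j, p ≤ i → i < j → j ≤ q → (∀ m, i ≤ m → m < j → m ∉ B) →
      i ∈ S ∪ ends B → j ∈ S ∪ ends B → (j - i : ℝ) ≤ 2 * U := by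
    intro i j h1 h2 h3 h4 h5 h6
    have := hCU i j (gap i j h1 h2 h3 h4 (Or.inl h5) (Or.inl h6))
    rw [segWeight_open h5 h6] at this
    linarith
  have key := length_le_of_runs B (p := p) (q := q) (runsIn B S p q)
    ((closedRuns_finite hB S).subset fun z hz => hz.1) (a := a) (t := t) (g := 2 * U)
    (α := (√5 + 2) * U) (by positivity) ?_ ?_ ?_ ?_ ?_ ?_ hin hout
  · calc _ ≤ _ := key
      _ = _ := by ring
  · intro i j h1 h2 h3 h4 h5 h6
    exact crun i j h1.le h2 h3.le h4 (h.interior i h1 (by omega)) (h.interior j (by omega) h3) h5 h6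
  · intro i j h1 h2 h3 h4 h5 h6
    exact ogap i j h1.le h2 h3.le h4 (Or.inr (Or.inr h5)) (Or.inr (Or.inl h6))
  · intro j h1 h2 h3 h4
    have hj := h.interior j h1 h2
    rcases ha with ⟨hp, rfl⟩ | ⟨hp, -, rfl⟩
    · left
      simpa only [segWeight_left hp hj, one_mul] using
        hBU p j (run p j le_rfl h1 h2.le h3 (Or.inl hp) (Or.inr h4))
    · right
      have := crun p j le_rfl h1 h2.le h3 hp hj (hleft hp) h4
      exact ⟨this.1, by linarith [this.2]⟩
  · intro j h1 h2 h3 h4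
    rcases ha with ⟨hp, rfl⟩ | ⟨hp, hp', rfl⟩
    · have := ogap p j le_rfl h1 h2.le h3 (Or.inl hp) (Or.inr (Or.inl h4))
      linarith
    · exact absurd hp' (h3 p le_rfl h1)
  · intro i h1 h2 h3 h4
    have hi := h.interior i h1 h2
    have ht0 : 0 ≤ t := by rcases ht with ⟨-, rfl⟩ | ⟨-, -, rfl⟩ | ⟨-, rfl⟩ <;> linarith
    by_cases hq : q ∈ S
    · left
      obtain rfl : t = 3 * U := by
        rcases ht with ⟨-, rfl⟩ | ⟨hq', -⟩ | ⟨hq', -⟩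
        · rfl
        · exact absurd hq hq'
        · exact absurd hq hq'
      have := hBU i q (run i q h1.le h2 le_rfl h3 (Or.inr h4) (Or.inl hq))
      rw [segWeight_right hi hq] at this
      linarith
    · right
      have := crun i q h1.le h2 le_rfl h3 hi hq h4 (hright hq)
      exact ⟨this.1, by linarith [this.2]⟩
  · intro i h1 h2 h3 h4
    have hi : i ∈ S ∪ ends B := Or.inr (Or.inr h4)
    rcases ht with ⟨hq, rfl⟩ | ⟨hq, hq', rfl⟩ | ⟨hq, rfl⟩
    · have := ogap i q h1.le h2 le_rfl h3 hi (Or.inl hq)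
      linarith
    · exact absurd hq' (h3 _ (by omega) (by omega))
    · have hq2 : q ∉ S ∪ ends B := by
        rintro (hh | hh | hh)
        · exact hq hh
        · exact hright hq hh
        · exact h3 _ (by omega) (by omega) hh
      simpa only [segWeight_left hi hq2, one_mul] using
        hCU i q (gap i q h1.le h2 le_rfl h3 (Or.inl hi) (Or.inr (hright' hq)))

/-- The integers `m` for which `{m, m + 1}` is a label of the join-tree. -/
def edgeIdx (A : JoinTree ℤ) : Set ℤ := {m | s(m, m + 1) ∈ A.graph}

theorem mk_succ_injective : Function.Injective fun m : ℤ => s(m, m + 1) := by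
  intro m m' h
  rcases Sym2.eq_iff.mp h with h | h <;> omega

theorem edgeIdx_finite (A : JoinTree ℤ) : (edgeIdx A).Finite :=
  A.graph.finite_toSet.preimage mk_succ_injective.injOn

/-- `B` and `C` are the children of `A`, in some order. -/
def Children (A B C : JoinTree ℤ) : Prop := A = node B C ∨ A = node C B

theorem Children.symm {A B C : JoinTree ℤ} (h : Children A B C) : Children A C B := Or.symm h

theorem Children.edgeIdx_eq {A B C : JoinTree ℤ} (h : Children A B C) :
    edgeIdx A = edgeIdx B ∪ edgeIdx C := by
  rcases h with rfl | rfl <;> ext m <;> simp [edgeIdx, graph, or_comm]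

theorem Children.sub {A B C : JoinTree ℤ} (h : Children A B C) : Sub B A := by
  rcases h with rfl | rfl
  · exact Sub.left (Sub.refl _)
  · exact Sub.right (Sub.refl _)

theorem Children.sizeOf_lt {A B C : JoinTree ℤ} (h : Children A B C) : sizeOf B < sizeOf A := by
  rcases h with rfl | rfl <;> rw [JoinTree.node.sizeOf_spec] <;> omega

theorem JoinTree.Over.of_sub {E : Set (Sym2 ℤ)} {A D : JoinTree ℤ} (hA : Over E A) (h : Sub D A) :
    Over E D := fun _ he => hA (graph_mono_of_sub h he)

theorem edgeIdx_subset_of_sub {A D : JoinTree ℤ} (h : Sub D A) : edgeIdx D ⊆ edgeIdx A :=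
  fun _ hm => graph_mono_of_sub h hm

theorem JoinTree.Sub.trans {A B D : JoinTree ℤ} (h : Sub D B) (h' : Sub B A) : Sub D A := by
  induction h' with
  | empty A =>
    cases h with
    | empty => exact Sub.empty _
    | refl => exact Sub.empty _
  | refl => exact h
  | left _ ih => exact Sub.left (ih h)
  | right _ ih => exact Sub.right (ih h)

/-- The inequalities satisfied by the potential for the constant weighting `1`, in which
`Δ(A|S)` is the number of closed components of `A|S`. -/
structure IsUnitPotential (E : Set (Sym2 ℤ)) (f : JoinTree ℤ → Set ℤ → ℝ) : Prop where
  leaf : ∀ l S, Over E (leaf l) → (numClosed (edgeIdx (leaf l)) S : ℝ) ≤ f (leaf l) S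
  dagger : ∀ A B C S, Over E A → Children A B C →
    f B S + numClosed (edgeIdx C) (S ∪ ends (edgeIdx B)) ≤ f A S
  inverted : ∀ A B C S, Over E A → Children A B C →
    numClosed (edgeIdx B) S + f C (S ∪ ends (edgeIdx B)) ≤ f A S
  half : ∀ A D S, Over E A → SubP D A → ¬ ends (edgeIdx D) ⊆ S →
    (f D S + f A (S ∪ ends (edgeIdx D)) + numClosed (edgeIdx A) S) / 2 ≤ f A S

/-- The exponential of the excess of `f(A|S)` over the number of closed components. -/
def expExcess (f : JoinTree ℤ → Set ℤ → ℝ) (A : JoinTree ℤ) (S : Set ℤ) : ℝ :=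
  (√5 + 5) ^ (f A S - numClosed (edgeIdx A) S)

theorem expExcess_pos (f : JoinTree ℤ → Set ℤ → ℝ) (A : JoinTree ℤ) (S : Set ℤ) :
    0 < expExcess f A S := Real.rpow_pos_of_pos (by positivity) _

theorem one_lt_base : 1 < √5 + 5 := by linarith [sqrt_five_gt]

theorem pow_mul_expExcess_le {f : JoinTree ℤ → Set ℤ → ℝ} {A D : JoinTree ℤ} {S T : Set ℤ}
    {n : ℕ} (h : n + (f D T - numClosed (edgeIdx D) T) ≤ f A S - numClosed (edgeIdx A) S) :
    (√5 + 5) ^ n * expExcess f D T ≤ expExcess f A S := by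
  unfold expExcess
  rw [← Real.rpow_natCast, ← Real.rpow_add (by positivity)]
  exact Real.rpow_le_rpow_of_exponent_le one_lt_base.le h

namespace IsUnitPotential

variable {E : Set (Sym2 ℤ)} {f : JoinTree ℤ → Set ℤ → ℝ}

theorem numClosed_le (hf : IsUnitPotential E f) {A : JoinTree ℤ} (hA : Over E A) (S : Set ℤ) :
    (numClosed (edgeIdx A) S : ℝ) ≤ f A S := by
  induction A generalizing S with
  | leaf l => exact hf.leaf l S hA
  | node B C hB _ =>
    have h : Children (node B C) B C := Or.inl rfl
    have h1 := hf.dagger _ B C S hA h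
    have h2 := hB (hA.of_sub h.sub) S
    have h3 := numClosed_union_le (edgeIdx_finite B) (edgeIdx_finite C) S
    rw [← h.edgeIdx_eq] at h3
    have h4 : (numClosed (edgeIdx (node B C)) S : ℝ) ≤
        numClosed (edgeIdx B) S + numClosed (edgeIdx C) (S ∪ ends (edgeIdx B)) := by
      exact_mod_cast h3
    linarith

theorem one_le_expExcess (hf : IsUnitPotential E f) {A : JoinTree ℤ} (hA : Over E A)
    (S : Set ℤ) : 1 ≤ expExcess f A S :=
  Real.one_le_rpow one_lt_base.le (sub_nonneg.mpr (hf.numClosed_le hA S))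

theorem expExcess_children (hf : IsUnitPotential E f) {A B C : JoinTree ℤ} (hA : Over E A)
    (h : Children A B C) {S : Set ℤ} {n : ℕ}
    (hn : numClosed (edgeIdx A) S + n ≤
      numClosed (edgeIdx B) S + numClosed (edgeIdx C) (S ∪ ends (edgeIdx B))) :
    (√5 + 5) ^ n * expExcess f B S ≤ expExcess f A S ∧
      (√5 + 5) ^ n * expExcess f C (S ∪ ends (edgeIdx B)) ≤ expExcess f A S := by
  have h1 := hf.dagger A B C S hA h
  have h2 := hf.inverted A B C S hA h
  have h3 : (numClosed (edgeIdx A) S + n : ℝ) ≤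
      numClosed (edgeIdx B) S + numClosed (edgeIdx C) (S ∪ ends (edgeIdx B)) := by
    exact_mod_cast hn
  exact ⟨pow_mul_expExcess_le (by linarith), pow_mul_expExcess_le (by linarith)⟩

theorem mul_expExcess_le_sq (hf : IsUnitPotential E f) {A D : JoinTree ℤ} (hA : Over E A)
    (h : SubP D A) {S : Set ℤ} (hS : ¬ ends (edgeIdx D) ⊆ S) :
    expExcess f D S * expExcess f A (S ∪ ends (edgeIdx D)) ≤ expExcess f A S ^ 2 := by
  have h1 := hf.half A D S hA h hS
  have h2 := numClosed_union_le (edgeIdx_finite D) (edgeIdx_finite A) S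
  rw [Set.union_eq_self_of_subset_left (edgeIdx_subset_of_sub h.1)] at h2
  have h3 : (numClosed (edgeIdx A) S : ℝ) ≤
      numClosed (edgeIdx D) S + numClosed (edgeIdx A) (S ∪ ends (edgeIdx D)) := by
    exact_mod_cast h2
  unfold expExcess
  rw [← Real.rpow_natCast, ← Real.rpow_mul (by positivity), ← Real.rpow_add (by positivity)]
  exact Real.rpow_le_rpow_of_exponent_le one_lt_base.le (by push_cast; linarith)

end IsUnitPotential

/-- The potential of `A` bounds the length of each component. -/
def BoundsSegments (f : JoinTree ℤ → Set ℤ → ℝ) (A : JoinTree ℤ) : Prop :=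
  ∀ S p q, IsSegment (edgeIdx A) S p q → segWeight S p q * (q - p) ≤ expExcess f A S

theorem IsSegment.length_of_leaf {l : Option (Sym2 ℤ)} {S : Set ℤ} {p q : ℤ}
    (h : IsSegment (edgeIdx (JoinTree.leaf l)) S p q) : q = p + 1 := by
  have h1 := h.mem p le_rfl h.lt
  by_contra hq
  have hlt := h.lt
  have h2 := h.mem (p + 1) (by omega) (by omega)
  cases l with
  | none => simp [edgeIdx, graph] at h1
  | some e =>
    simp only [edgeIdx, graph, Set.mem_ofPred_eq, Finset.mem_singleton] at h1 h2
    have := mk_succ_injective (h1.trans h2.symm)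
    omega

theorem IsSegment.of_subset {A B S : Set ℤ} {p q : ℤ} (h : IsSegment A S p q) (hBA : B ⊆ A)
    (hB : ∀ m, p ≤ m → m < q → m ∈ B) : IsSegment B S p q :=
  ⟨h.lt, hB, h.interior, h.left.imp_right fun h h' => h (hBA h'),
    h.right.imp_right fun h h' => h (hBA h')⟩

theorem bernoulli_base (n : ℕ) : 1 + n * (√5 + 4) ≤ (√5 + 5) ^ n := by
  have := one_add_mul_le_pow (a := √5 + 4) (by linarith [sqrt_five_gt]) n
  rwa [show 1 + (√5 + 4) = √5 + 5 by ring] at this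

namespace IsUnitPotential

variable {E : Set (Sym2 ℤ)} {f : JoinTree ℤ → Set ℤ → ℝ}

theorem boundsSegments_leaf (hf : IsUnitPotential E f) {l : Option (Sym2 ℤ)}
    (hl : Over E (JoinTree.leaf l)) : BoundsSegments f (JoinTree.leaf l) := by
  intro S p q h
  have h1 := segWeight_le_one S p q
  have h2 := hf.one_le_expExcess hl S
  have h3 := h.length_of_leaf
  subst h3
  push_cast
  linarith

/-- Length bound for a component `[p, q]` of `A|S` that is not closed, provided it
is neither contained in nor disjoint from the child `B`. -/
theorem length_le_of_children (hf : IsUnitPotential E f) {A B C : JoinTree ℤ} (hA : Over E A)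
    (h : Children A B C) (hB : BoundsSegments f B) (hC : BoundsSegments f C)
    {S : Set ℤ} {p q : ℤ} (hs : IsSegment (edgeIdx A) S p q) (hpq : p ∈ S ∨ q ∈ S)
    {a t : ℝ} (ha : (p ∈ S ∧ a = 1) ∨ (p ∉ S ∧ p ∈ edgeIdx B ∧ a = -2))
    (ht : (q ∈ S ∧ t = 3) ∨ (q ∉ S ∧ q - 1 ∈ edgeIdx B ∧ t = 0) ∨ (q ∉ S ∧ t = 1))
    (hin : ∃ m, p ≤ m ∧ m < q ∧ m ∈ edgeIdx B) (hout : ∃ m, p ≤ m ∧ m < q ∧ m ∉ edgeIdx B) :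
    (q - p : ℝ) * (√5 + 5) ^ (runsIn (edgeIdx B) S p q).ncard ≤
      (a + t + (runsIn (edgeIdx B) S p q).ncard * (√5 + 4)) * expExcess f A S := by
  set n := (runsIn (edgeIdx B) S p q).ncard
  rw [h.edgeIdx_eq] at hs
  have hn := hs.numClosed_add_le (edgeIdx_finite B) (edgeIdx_finite C) hpq
  rw [← h.edgeIdx_eq] at hn
  obtain ⟨h1, h2⟩ := hf.expExcess_children hA h hn
  have hb : 0 < (√5 + 5) ^ n := by positivity
  rw [mul_comm, ← le_div_iff₀ hb] at h1 h2
  have hU : 0 ≤ expExcess f A S / (√5 + 5) ^ n := div_nonneg (expExcess_pos f A S).le hb.le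
  have key := hs.length_le (edgeIdx_finite B) (a := a * (expExcess f A S / (√5 + 5) ^ n))
    (t := t * (expExcess f A S / (√5 + 5) ^ n)) hU
    (fun i j hij => (hB S i j hij).trans h1) (fun i j hij => (hC _ i j hij).trans h2)
    (by rcases ha with ⟨h, rfl⟩ | ⟨h, h', rfl⟩
        · exact Or.inl ⟨h, by ring⟩
        · exact Or.inr ⟨h, h', by ring⟩)
    (by rcases ht with ⟨h, rfl⟩ | ⟨h, h', rfl⟩ | ⟨h, rfl⟩
        · exact Or.inl ⟨h, by ring⟩
        · exact Or.inr (Or.inl ⟨h, h', by ring⟩)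
        · exact Or.inr (Or.inr ⟨h, by ring⟩)) hin hout
  rw [← le_div_iff₀ hb]
  refine key.trans (le_of_eq ?_)
  ring

theorem length_le_of_half_open (hf : IsUnitPotential E f) {A B C : JoinTree ℤ} (hA : Over E A)
    (h : Children A B C) (hB : BoundsSegments f B) (hC : BoundsSegments f C)
    {S : Set ℤ} {p q : ℤ} (hs : IsSegment (edgeIdx A) S p q)
    (hpq : (p ∈ S ∧ q ∉ S ∧ q - 1 ∈ edgeIdx B) ∨ (p ∉ S ∧ q ∈ S ∧ p ∈ edgeIdx B)) :
    (q - p : ℝ) ≤ expExcess f A S := by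
  have hlt := hs.lt
  by_cases hw : ∀ m, p ≤ m → m < q → m ∈ edgeIdx B
  · have h1 := hB S p q (hs.of_subset (edgeIdx_subset_of_sub h.sub) hw)
    have h2 := numClosed_union_le (edgeIdx_finite B) (edgeIdx_finite C) S
    rw [← h.edgeIdx_eq] at h2
    have h3 := (hf.expExcess_children hA h (n := 0) h2).1
    have h4 : segWeight S p q = 1 := by
      rcases hpq with ⟨h, h', -⟩ | ⟨h, h', -⟩
      · exact segWeight_left h h'
      · exact segWeight_right h h'
    rw [h4] at h1
    linarith
  push Not at hw
  have hb := bernoulli_base (runsIn (edgeIdx B) S p q).ncard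
  have hM := expExcess_pos f A S
  have key : (q - p : ℝ) * (√5 + 5) ^ (runsIn (edgeIdx B) S p q).ncard ≤
      (1 + (runsIn (edgeIdx B) S p q).ncard * (√5 + 4)) * expExcess f A S := by
    rcases hpq with ⟨h1, h2, h3⟩ | ⟨h1, h2, h3⟩
    · simpa using hf.length_le_of_children hA h hB hC hs (Or.inl h1) (Or.inl ⟨h1, rfl⟩)
        (Or.inr (Or.inl ⟨h2, h3, rfl⟩)) ⟨q - 1, by omega, by omega, h3⟩ hw
    · have := hf.length_le_of_children hA h hB hC hs (Or.inr h2) (Or.inr ⟨h1, h3, rfl⟩)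
        (Or.inl ⟨h2, rfl⟩) ⟨p, le_rfl, hlt, h3⟩ hw
      norm_num at this ⊢
      linarith
  have hpos : 0 < (√5 + 5) ^ (runsIn (edgeIdx B) S p q).ncard := by positivity
  refine le_of_mul_le_mul_right (key.trans ?_) hpos
  rw [mul_comm (expExcess f A S)]
  exact mul_le_mul_of_nonneg_right hb hM.le

theorem length_le_of_open (hf : IsUnitPotential E f) {A B C : JoinTree ℤ} (hA : Over E A)
    (h : Children A B C) (hB : BoundsSegments f B) (hC : BoundsSegments f C)
    {S : Set ℤ} {p q : ℤ} (hs : IsSegment (edgeIdx A) S p q) (hp : p ∈ S) (hq : q ∈ S)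
    (hmid : p + (q - p) / 2 ∈ edgeIdx B) :
    (q - p : ℝ) ≤ 2 * expExcess f A S := by
  have hlt := hs.lt
  set e := p + (q - p) / 2 with he
  have hBA : expExcess f B S ≤ expExcess f A S := by
    have h2 := numClosed_union_le (edgeIdx_finite B) (edgeIdx_finite C) S
    rw [← h.edgeIdx_eq] at h2
    simpa using (hf.expExcess_children hA h (n := 0) h2).1
  by_cases hw : ∀ m, p ≤ m → m < q → m ∈ edgeIdx B
  · have h1 := hB S p q (hs.of_subset (edgeIdx_subset_of_sub h.sub) hw)
    rw [segWeight_open hp hq] at h1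
    linarith
  push Not at hw
  obtain ⟨i, hi1, hi2, hi3, hi4⟩ := exists_run_start _ (by omega : p ≤ e) hmid
  obtain ⟨j, hj1, hj2, hj3, hj4⟩ := exists_run_end _ (by omega : e < q) hmid
  have hij : ∀ m, i ≤ m → m < j → m ∈ edgeIdx B := fun m h1 h2 => by
    by_cases hme : m ≤ e
    · exact hi3 m h1 hme
    · exact hj3 m (by omega) h2
  have hseg : IsSegment (edgeIdx B) S i j :=
    ⟨by omega, hij, fun m h1 h2 => hs.interior m (by omega) (by omega),
      hi4.imp_left fun (h' : i = p) => by rw [h']; exact hp,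
      hj4.imp_left fun (h' : j = q) => by rw [h']; exact hq⟩
  have hb := hB S i j hseg
  by_cases hip : i = p
  · have hjq : j ≠ q := by
      rintro rfl
      obtain ⟨m, h1, h2, h3⟩ := hw
      exact h3 (hij m (hip ▸ h1) h2)
    rw [segWeight_left (hip ▸ hp) (hs.interior j (by omega) (by omega))] at hb
    have : q - p ≤ 2 * (j - i) := by omega
    have : (q - p : ℝ) ≤ 2 * (j - i) := by exact_mod_cast this
    linarith
  by_cases hjq : j = q
  · rw [segWeight_right (hs.interior i (by omega) (by omega)) (hjq ▸ hq)] at hb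
    have : q - p ≤ 2 * (j - i) := by omega
    have : (q - p : ℝ) ≤ 2 * (j - i) := by exact_mod_cast this
    linarith
  have hmem : (i, j) ∈ runsIn (edgeIdx B) S p q :=
    ⟨hseg.isClosedRun (hs.interior i (by omega) (by omega))
      (hs.interior j (by omega) (by omega)), hi1, hj2⟩
  have hn : 1 ≤ (runsIn (edgeIdx B) S p q).ncard :=
    Nat.one_le_iff_ne_zero.mpr (Set.ncard_ne_zero_of_mem hmem
      ((closedRuns_finite (edgeIdx_finite B) S).subset fun z hz => hz.1))
  have key := hf.length_le_of_children hA h hB hC hs (Or.inl hp) (Or.inl ⟨hp, rfl⟩)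
    (Or.inl ⟨hq, rfl⟩) ⟨e, by omega, by omega, hmid⟩ hw
  set n := (runsIn (edgeIdx B) S p q).ncard
  have hbern := bernoulli_base n
  have hM := expExcess_pos f A S
  have hn' : (1 : ℝ) ≤ n := by exact_mod_cast hn
  have h5 := sqrt_five_gt
  refine le_of_mul_le_mul_right (key.trans ?_) (by positivity : 0 < (√5 + 5) ^ n)
  rw [mul_right_comm]
  exact mul_le_mul_of_nonneg_right (by nlinarith) hM.le

theorem segWeight_mul_le_of_not_closed (hf : IsUnitPotential E f) {A B C : JoinTree ℤ}
    (hA : Over E A) (h : Children A B C) (hB : BoundsSegments f B) (hC : BoundsSegments f C)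
    {S : Set ℤ} {p q : ℤ} (hs : IsSegment (edgeIdx A) S p q) (hpq : p ∈ S ∨ q ∈ S) :
    segWeight S p q * (q - p) ≤ expExcess f A S := by
  have hlt := hs.lt
  have hmem : ∀ m, p ≤ m → m < q → m ∈ edgeIdx B ∨ m ∈ edgeIdx C := fun m h1 h2 => by
    have := hs.mem m h1 h2
    rwa [h.edgeIdx_eq] at this
  by_cases hp : p ∈ S <;> by_cases hq : q ∈ S
  · rw [segWeight_open hp hq]
    rcases hmem (p + (q - p) / 2) (by omega) (by omega) with hm | hm
    · linarith [hf.length_le_of_open hA h hB hC hs hp hq hm]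
    · linarith [hf.length_le_of_open hA h.symm hC hB hs hp hq hm]
  · rw [segWeight_left hp hq, one_mul]
    rcases hmem (q - 1) (by omega) (by omega) with hm | hm
    · exact hf.length_le_of_half_open hA h hB hC hs (Or.inl ⟨hp, hq, hm⟩)
    · exact hf.length_le_of_half_open hA h.symm hC hB hs (Or.inl ⟨hp, hq, hm⟩)
  · rw [segWeight_right hp hq, one_mul]
    rcases hmem p le_rfl hlt with hm | hm
    · exact hf.length_le_of_half_open hA h hB hC hs (Or.inr ⟨hp, hq, hm⟩)
    · exact hf.length_le_of_half_open hA h.symm hC hB hs (Or.inr ⟨hp, hq, hm⟩)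
  · exact absurd hpq (by simp [hp, hq])

end IsUnitPotential

theorem IsClosedRun.two_le_ncard_runsIn {B S : Set ℤ} (hB : B.Finite) {p r e q : ℤ}
    (h : IsClosedRun B S p r) (hre : r < e) (he : e ∈ B) (heq : e < q) (hq : q ∉ B)
    (hS : ∀ m, p ≤ m → m ≤ q → m ∉ S) : 2 ≤ (runsIn B S p q).ncard := by
  have hpr := h.lt
  obtain ⟨i, hi1, hi2, hi3, hi4⟩ := exists_run_start B hre.le he
  obtain ⟨j, hj1, hj2, hj3, hj4⟩ := exists_run_end B heq he
  have hi : i - 1 ∉ B := by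
    rcases hi4 with rfl | hi4
    · exact absurd (hi3 i le_rfl hi2) h.right
    · exact hi4
  have hj : j ∉ B := by
    rcases hj4 with rfl | hj4
    · exact hq
    · exact hj4
  have hij : IsClosedRun B S i j := by
    refine ⟨by omega, fun m h1 h2 => ?_, hi, hj, fun m h1 h2 => hS m (by omega) (by omega)⟩
    by_cases hm : m ≤ e
    · exact hi3 m h1 hm
    · exact hj3 m (by omega) h2
  have hsub : {(p, r), (i, j)} ⊆ runsIn B S p q := by
    rintro z (rfl | rfl)
    · exact ⟨h, le_rfl, by dsimp; omega⟩
    · exact ⟨hij, by dsimp; omega, hj2⟩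
  rw [← Set.ncard_pair (a := (p, r)) (b := (i, j)) (by simp; omega)]
  exact Set.ncard_le_ncard hsub ((closedRuns_finite hB S).subset fun z hz => hz.1)

/-- If `[p, r]` is the only run of `B` in `[p, q]`, then `[r, q]` is a half-open component of
`C|S ∪ V(B)`. -/
theorem IsClosedRun.isSegment_gap {B C S : Set ℤ} {p q r : ℤ} (h : IsClosedRun B S p r)
    (hrq : r < q) (hS : ∀ m, p ≤ m → m ≤ q → m ∉ S) (hB : ∀ m, r < m → m < q → m ∉ B)
    (hC : ∀ m, r ≤ m → m < q → m ∈ C) (hqC : q ∉ C) (hqB : q ∉ B) :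
    IsSegment C (S ∪ ends B) r q ∧ r ∈ S ∪ ends B ∧ q ∉ S ∪ ends B := by
  have hpr := h.lt
  have hB' : ∀ m, r ≤ m → m < q → m ∉ B := fun m h1 h2 => by
    rcases eq_or_lt_of_le h1 with rfl | h1
    · exact h.right
    · exact hB m h1 h2
  have hr : r ∈ S ∪ ends B := Or.inr (Or.inr (h.mem _ (by omega) (by omega)))
  refine ⟨⟨hrq, hC, ?_, Or.inl hr, Or.inr hqC⟩, hr, ?_⟩
  · rintro m h1 h2 (hm | hm | hm)
    · exact hS m (by omega) h2.le hm
    · exact hB m h1 h2 hm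
    · exact hB' (m - 1) (by omega) (by omega) hm
  · rintro (hm | hm | hm)
    · exact hS q (by omega) le_rfl hm
    · exact hqB hm
    · exact hB' (q - 1) (by omega) (by omega) hm

theorem ends_union (B C : Set ℤ) : ends (B ∪ C) = ends B ∪ ends C := by
  ext v
  simp only [ends, Set.mem_union, Set.mem_ofPred_eq]
  tauto

namespace IsUnitPotential

variable {E : Set (Sym2 ℤ)} {f : JoinTree ℤ → Set ℤ → ℝ}

theorem add_numClosed_le_of_children (hf : IsUnitPotential E f) {A D B C : JoinTree ℤ}
    (hD : Over E D) (hDA : Sub D A) (h : Children D B C) {S : Set ℤ}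
    (hg : f D S + numClosed (edgeIdx A) (S ∪ ends (edgeIdx D)) ≤ f A S) :
    f B S + numClosed (edgeIdx A) (S ∪ ends (edgeIdx B)) ≤ f A S := by
  have h1 := hf.dagger D B C S hD h
  have h2 := numClosed_union_le (edgeIdx_finite C) (edgeIdx_finite A) (S ∪ ends (edgeIdx B))
  rw [Set.union_eq_self_of_subset_left (edgeIdx_subset_of_sub (h.symm.sub.trans hDA)),
    Set.union_assoc, ← ends_union, ← h.edgeIdx_eq] at h2
  have h3 : (numClosed (edgeIdx A) (S ∪ ends (edgeIdx B)) : ℝ) ≤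
      numClosed (edgeIdx C) (S ∪ ends (edgeIdx B)) +
        numClosed (edgeIdx A) (S ∪ ends (edgeIdx D)) := by exact_mod_cast h2
  linarith

theorem pow_mul_expExcess_le_of_sub {A D : JoinTree ℤ} {S : Set ℤ} {n : ℕ}
    (hn : numClosed (edgeIdx A) S + n ≤
      numClosed (edgeIdx D) S + numClosed (edgeIdx A) (S ∪ ends (edgeIdx D)))
    (hg : f D S + numClosed (edgeIdx A) (S ∪ ends (edgeIdx D)) ≤ f A S) :
    (√5 + 5) ^ n * expExcess f D S ≤ expExcess f A S := by
  have h3 : (numClosed (edgeIdx A) S + n : ℝ) ≤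
      numClosed (edgeIdx D) S + numClosed (edgeIdx A) (S ∪ ends (edgeIdx D)) := by
    exact_mod_cast hn
  exact pow_mul_expExcess_le (by linarith)

theorem exists_long_run_of_children (hf : IsUnitPotential E f) {A : JoinTree ℤ} (hA : Over E A)
    (hlow : ∀ D, sizeOf D < sizeOf A → Over E D → BoundsSegments f D)
    (hopen : ∀ S p q, IsSegment (edgeIdx A) S p q → (p ∈ S ∨ q ∈ S) →
      segWeight S p q * (q - p) ≤ expExcess f A S)
    {S : Set ℤ} {p q : ℤ} (h : IsClosedRun (edgeIdx A) S p q)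
    (hlt : expExcess f A S < (√5 - 2) * (q - p)) {D B C : JoinTree ℤ} (hDA : Sub D A)
    (hsize : sizeOf D ≤ sizeOf A) (hc : Children D B C)
    (hg : f D S + numClosed (edgeIdx A) (S ∪ ends (edgeIdx D)) ≤ f A S)
    {q' : ℤ} (h' : IsClosedRun (edgeIdx D) S p q') (hl : (√5 - 1) / 2 * (q - p) ≤ q' - p)
    (hp : p ∈ edgeIdx B) :
    ∃ r, IsClosedRun (edgeIdx B) S p r ∧ (√5 - 1) / 2 * (q - p) ≤ r - p := by
  have h5 := sqrt_five_gt
  have h5' := sqrt_five_lt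
  have h55 := sqrt_five_sq
  have hpq' := h'.lt
  have hpq := h.lt
  have hpqR : (0 : ℝ) < q - p := by exact_mod_cast sub_pos.mpr hpq
  have hBD := edgeIdx_subset_of_sub hc.sub
  have hDA' := edgeIdx_subset_of_sub hDA
  have hBA : Sub B A := hc.sub.trans hDA
  have hB := hlow B (hc.sizeOf_lt.trans_le hsize) (hA.of_sub hBA)
  have hC := hlow C (hc.symm.sizeOf_lt.trans_le hsize) (hA.of_sub (hc.symm.sub.trans hDA))
  have hgB := hf.add_numClosed_le_of_children (hA.of_sub hDA) hDA hc hg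
  have hDW : expExcess f D S ≤ expExcess f A S := by
    have h2 := numClosed_union_le (edgeIdx_finite D) (edgeIdx_finite A) S
    rw [Set.union_eq_self_of_subset_left hDA'] at h2
    simpa using pow_mul_expExcess_le_of_sub (n := 0) h2 hg
  have hW := expExcess_pos f A S
  have hq'q : q' ≤ q := by
    by_contra hcon
    exact h.right (hDA' (h'.mem q hpq.le (by omega)))
  have hq'B : q' ∉ edgeIdx B := fun hh => h'.right (hBD hh)
  obtain ⟨r, hr1, hr2, hr3, hr4⟩ := exists_run_end _ hpq' hp
  have hr : IsClosedRun (edgeIdx B) S p r :=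
    ⟨hr1, hr3, fun hh => h'.left (hBD hh), by rcases hr4 with rfl | hr4 <;> assumption,
      fun m h1 h2 => h'.disj m h1 (by omega)⟩
  refine ⟨r, hr, ?_⟩
  rcases eq_or_lt_of_le hr2 with rfl | hrq'
  · exact hl
  by_cases hex : ∃ e, r < e ∧ e < q' ∧ e ∈ edgeIdx B
  · exfalso
    obtain ⟨e, he1, he2, he3⟩ := hex
    have hn := hr.two_le_ncard_runsIn (edgeIdx_finite B) he1 he3 he2 hq'B h'.disj
    have hcount := h'
    rw [hc.edgeIdx_eq] at hcount
    have hcnt := hcount.numClosed_add_le (edgeIdx_finite B) (edgeIdx_finite C)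
    rw [← hc.edgeIdx_eq] at hcnt
    obtain ⟨m, hm⟩ : ∃ m, (runsIn (edgeIdx B) S p q').ncard = m + 2 :=
      Nat.exists_eq_add_of_le' hn
    obtain ⟨h1, h2⟩ := hf.expExcess_children (hA.of_sub hDA) hc (S := S) (n := m + 1)
      (by omega)
    have hb : 0 < (√5 + 5) ^ (m + 1) := by positivity
    replace h1 := h1.trans hDW
    replace h2 := h2.trans hDW
    rw [mul_comm, ← le_div_iff₀ hb] at h1 h2
    set U := expExcess f A S / (√5 + 5) ^ (m + 1)
    have hU : 0 ≤ U := div_nonneg hW.le hb.le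
    have key := hcount.isSegment.length_le (edgeIdx_finite B) (a := -2 * U) (t := U) hU
      (fun i j hij => (hB S i j hij).trans h1) (fun i j hij => (hC _ i j hij).trans h2)
      (Or.inr ⟨h'.disj p le_rfl hpq'.le, hp, rfl⟩)
      (Or.inr (Or.inr ⟨h'.disj q' hpq'.le le_rfl, rfl⟩))
      ⟨p, le_rfl, hpq', hp⟩ ⟨r, hr1.le, hrq', hr.right⟩
    rw [hm] at key
    have hUW : U * (√5 + 5) ^ (m + 1) = expExcess f A S := div_mul_cancel₀ _ hb.ne'
    have hbern := bernoulli_base (m + 1)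
    push_cast at key hbern
    have hm0 : (0 : ℝ) ≤ m := by positivity
    have h6 : U * (1 + (m + 1) * (√5 + 4)) ≤ expExcess f A S := by
      rw [← hUW]
      exact mul_le_mul_of_nonneg_left hbern hU
    have h7 : 0 ≤ U * (m * (√5 + 4)) := by positivity
    have h8 : (q' - p : ℝ) ≤ 2 * expExcess f A S := by linarith
    have h9 : (q' - p : ℝ) < 2 * ((√5 - 2) * (q - p)) := by linarith
    nlinarith
  push Not at hex
  have hCseg := hr.isSegment_gap hrq' h'.disj hex (C := edgeIdx C) (fun m h1 h2 => by
      have := h'.mem m (by omega) h2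
      rw [hc.edgeIdx_eq] at this
      refine this.resolve_left fun hm => ?_
      rcases eq_or_lt_of_le h1 with rfl | h1
      · exact hr.right hm
      · exact hex m h1 h2 hm) (fun hh => h'.right (edgeIdx_subset_of_sub hc.symm.sub hh)) hq'B
  have hgap : (q' - r : ℝ) ≤ expExcess f A S := by
    have h1 := hC _ _ _ hCseg.1
    rw [segWeight_left hCseg.2.1 hCseg.2.2] at h1
    have h2 := numClosed_union_le (edgeIdx_finite B) (edgeIdx_finite C) S
    rw [← hc.edgeIdx_eq] at h2
    have h3 := (hf.expExcess_children (hA.of_sub hDA) hc (n := 0) h2).2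
    linarith
  have hv : (3 - √5) / 2 * (q - p) ≤ (r - p : ℝ) := by linarith
  have hBr := hB S p r hr.isSegment
  rw [segWeight_closed (hr.disj p le_rfl hr1.le) (hr.disj r hr1.le le_rfl)] at hBr
  have hqB : q ∉ edgeIdx B := fun hh => h.right (hDA' (hBD hh))
  have hrq : r < q := by omega
  by_cases hex' : ∃ e, r < e ∧ e < q ∧ e ∈ edgeIdx B
  · exfalso
    obtain ⟨e, he1, he2, he3⟩ := hex'
    have hn := hr.two_le_ncard_runsIn (edgeIdx_finite B) he1 he3 he2 hqB h.disj
    have hcount := h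
    have hu := Set.union_eq_self_of_subset_left (hBD.trans hDA')
    rw [← hu] at hcount
    have hcnt := hcount.numClosed_add_le (edgeIdx_finite B) (edgeIdx_finite A)
    rw [hu] at hcnt
    have h1 := pow_mul_expExcess_le_of_sub (n := 1) (by omega) hgB
    rw [pow_one] at h1
    have h2 : (√5 + 5) * ((√5 - 2) * ((3 - √5) / 2 * (q - p))) < (√5 - 2) * (q - p) := by
      refine lt_of_le_of_lt ?_ (h1.trans_lt hlt)
      refine mul_le_mul_of_nonneg_left (le_trans ?_ hBr) (by linarith)
      exact mul_le_mul_of_nonneg_left hv (by linarith)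
    have h3 : (√5 + 5) * ((√5 - 2) * ((3 - √5) / 2 * (q - p))) =
        ((√5 - 2) * (q - p)) * (5 - √5) := by
      linear_combination (-(√5 - 2) * (q - p) / 2) * h55
    have h4 : 0 < (√5 - 2) * (q - p : ℝ) := mul_pos (by linarith) hpqR
    nlinarith
  push Not at hex'
  have hAseg := hr.isSegment_gap hrq h.disj hex' (C := edgeIdx A)
    (fun m h1 h2 => h.mem m (by omega) h2) h.right hqB
  have h1 := hopen _ _ _ hAseg.1 (Or.inl hAseg.2.1)
  rw [segWeight_left hAseg.2.1 hAseg.2.2, one_mul] at h1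
  have hBneA : B ≠ A := fun hh => (hc.sizeOf_lt.trans_le hsize).ne (congrArg sizeOf hh)
  have h2 := hf.mul_expExcess_le_sq hA ⟨hBA, hBneA⟩ (S := S)
    (fun hh => h.disj p le_rfl hpq.le (hh (Or.inl hp)))
  have hr1R : (0 : ℝ) < r - p := by exact_mod_cast sub_pos.mpr hr1
  have hrqR : (0 : ℝ) < q - r := by exact_mod_cast sub_pos.mpr hrq
  have h3 : (√5 - 2) * (r - p) * (q - r) ≤ expExcess f A S ^ 2 :=
    (mul_le_mul hBr h1 hrqR.le (expExcess_pos f B S).le).trans h2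
  have h4 : expExcess f A S ^ 2 < ((√5 - 2) * (q - p)) ^ 2 := pow_lt_pow_left₀ hlt hW.le two_ne_zero
  have h6 : (r - p : ℝ) * (q - r) < (√5 - 2) * (q - p) ^ 2 := by
    have : (√5 - 2) * ((r - p : ℝ) * (q - r)) < (√5 - 2) * ((√5 - 2) * (q - p) ^ 2) := by
      linarith
    exact lt_of_mul_lt_mul_left this (by linarith)
  by_contra hcon
  push Not at hcon
  have h7 : 0 ≤ ((r - p : ℝ) - (3 - √5) / 2 * (q - p)) * ((√5 - 1) / 2 * (q - p) - (r - p)) :=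
    mul_nonneg (by linarith) (by linarith)
  have h8 : ((r - p : ℝ) - (3 - √5) / 2 * (q - p)) * ((√5 - 1) / 2 * (q - p) - (r - p)) =
      (r - p) * (q - r) - (√5 - 2) * (q - p) ^ 2 := by
    linear_combination ((q - p : ℝ) ^ 2 / 4) * h55
  linarith

theorem le_expExcess_of_isClosedRun (hf : IsUnitPotential E f) {A : JoinTree ℤ} (hA : Over E A)
    (hlow : ∀ D, sizeOf D < sizeOf A → Over E D → BoundsSegments f D)
    (hopen : ∀ S p q, IsSegment (edgeIdx A) S p q → (p ∈ S ∨ q ∈ S) →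
      segWeight S p q * (q - p) ≤ expExcess f A S)
    {S : Set ℤ} {p q : ℤ} (h : IsClosedRun (edgeIdx A) S p q) :
    (√5 - 2) * (q - p) ≤ expExcess f A S := by
  by_contra! hlt
  have hpqR : (0 : ℝ) < q - p := by exact_mod_cast sub_pos.mpr h.lt
  have h5 := sqrt_five_gt
  have h5' := sqrt_five_lt
  have descent : ∀ D, Sub D A → sizeOf D ≤ sizeOf A →
      f D S + numClosed (edgeIdx A) (S ∪ ends (edgeIdx D)) ≤ f A S → ∀ q',
      IsClosedRun (edgeIdx D) S p q' → (√5 - 1) / 2 * (q - p) ≤ (q' - p : ℝ) → False := by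
    intro D
    induction D with
    | leaf l =>
      intro _ _ _ q' h' hl
      have h1 := hf.one_le_expExcess hA S
      rw [h'.isSegment.length_of_leaf] at hl
      push_cast at hl
      nlinarith
    | node B C ihB ihC =>
      intro hDA hsize hg q' h' hl
      have step : ∀ B' C', Children (node B C) B' C' → p ∈ edgeIdx B' →
          (Sub B' A → sizeOf B' ≤ sizeOf A →
            f B' S + numClosed (edgeIdx A) (S ∪ ends (edgeIdx B')) ≤ f A S → ∀ q',
            IsClosedRun (edgeIdx B') S p q' → (√5 - 1) / 2 * (q - p) ≤ (q' - p : ℝ) → False) →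
          False := by
        intro B' C' hc hp ih
        obtain ⟨r, hr, hlr⟩ :=
          hf.exists_long_run_of_children hA hlow hopen h hlt hDA hsize hc hg h' hl hp
        exact ih (hc.sub.trans hDA) (hc.sizeOf_lt.le.trans hsize)
          (hf.add_numClosed_le_of_children (hA.of_sub hDA) hDA hc hg) r hr hlr
      have hc : Children (node B C) B C := Or.inl rfl
      have hp := h'.mem p le_rfl h'.lt
      rw [hc.edgeIdx_eq] at hp
      rcases hp with hp | hp
      · exact step B C hc hp ihB
      · exact step C B hc.symm hp ihC
  refine descent A (Sub.refl A) le_rfl ?_ q h (by nlinarith)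
  have h0 : closedRuns (edgeIdx A) (S ∪ ends (edgeIdx A)) = ∅ := by
    refine Set.eq_empty_of_forall_notMem fun z hz => ?_
    exact hz.disj z.1 le_rfl hz.lt.le (Or.inr (Or.inl (hz.mem _ le_rfl hz.lt)))
  simp [numClosed, h0]

theorem boundsSegments (hf : IsUnitPotential E f) {A : JoinTree ℤ} (hA : Over E A) :
    BoundsSegments f A := by
  induction hn : sizeOf A using Nat.strong_induction_on generalizing A with
  | _ n ih =>
    subst hn
    have hlow : ∀ D, sizeOf D < sizeOf A → Over E D → BoundsSegments f D :=
      fun D hD hE => ih _ hD hE rfl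
    cases A with
    | leaf l => exact hf.boundsSegments_leaf hA
    | node B C =>
      have hc : Children (node B C) B C := Or.inl rfl
      have hopen : ∀ S p q, IsSegment (edgeIdx (node B C)) S p q → (p ∈ S ∨ q ∈ S) →
          segWeight S p q * (q - p) ≤ expExcess f (node B C) S := fun S p q =>
        hf.segWeight_mul_le_of_not_closed hA hc (hlow B hc.sizeOf_lt (hA.of_sub hc.sub))
          (hlow C hc.symm.sizeOf_lt (hA.of_sub hc.symm.sub))
      intro S p q h
      by_cases hpq : p ∈ S ∨ q ∈ S
      · exact hopen S p q h hpq
      · push Not at hpq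
        rw [segWeight_closed hpq.1 hpq.2]
        exact hf.le_expExcess_of_isClosedRun hA hlow hopen (h.isClosedRun hpq.1 hpq.2)

end IsUnitPotential

/-- The edges of `I` with no endpoint in `S`. -/
def freeEdges (I S : Set ℤ) : Set ℤ := {m | m ∈ I ∧ m ∉ S ∧ m + 1 ∉ S}

theorem freeEdges_subset (I S : Set ℤ) : freeEdges I S ⊆ I := fun _ h => h.1

theorem ncard_freeEdges_add_le {A B C S : Set ℤ} (hA : A.Finite) (hBA : B ⊆ A) (hCA : C ⊆ A) :
    (freeEdges B S).ncard + (freeEdges C (S ∪ ends B)).ncard ≤ (freeEdges A S).ncard := by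
  rw [← Set.ncard_union_eq ?_ (hA.subset ((freeEdges_subset B S).trans hBA))
    (hA.subset ((freeEdges_subset C _).trans hCA))]
  · refine Set.ncard_le_ncard ?_ (hA.subset (freeEdges_subset A S))
    rintro m (⟨h1, h2⟩ | ⟨h1, h2, h3⟩)
    · exact ⟨hBA h1, h2⟩
    · exact ⟨hCA h1, fun h => h2 (Or.inl h), fun h => h3 (Or.inl h)⟩
  · exact Set.disjoint_left.mpr fun m h1 h2 => h2.2.1 (Or.inr (Or.inl h1.1))

theorem mem_of_reachable {F : Finset (Sym2 ℤ)} (hF : ∀ e ∈ F, ∃ m : ℤ, e = s(m, m + 1)) {u v : ℤ}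
    (h : (SimpleGraph.fromEdgeSet (F : Set (Sym2 ℤ))).Reachable u v) :
    (∀ m, u ≤ m → m < v → s(m, m + 1) ∈ F) ∧ (∀ m, v ≤ m → m < u → s(m, m + 1) ∈ F) := by
  obtain ⟨w⟩ := h
  induction w with
  | nil => exact ⟨fun m h1 h2 => by omega, fun m h1 h2 => by omega⟩
  | @cons u x v hux _ ih =>
    have hux' : s(u, x) ∈ F := ((SimpleGraph.fromEdgeSet_adj _).mp hux).1
    obtain ⟨m, hm⟩ := hF _ hux'
    rcases Sym2.eq_iff.mp hm with ⟨rfl, rfl⟩ | ⟨rfl, rfl⟩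
    · refine ⟨fun n h1 h2 => ?_, fun n h1 h2 => ih.2 n h1 (by omega)⟩
      rcases eq_or_lt_of_le h1 with rfl | h1
      · exact hux'
      · exact ih.1 n (by omega) h2
    · refine ⟨fun n h1 h2 => ih.1 n (by omega) h2, fun n h1 h2 => ?_⟩
      rcases eq_or_lt_of_le (by omega : n ≤ x) with rfl | h2
      · exact hm ▸ hux'
      · exact ih.2 n h1 h2

theorem vset_graph_eq {A : JoinTree ℤ} (hA : ∀ e ∈ A.graph, ∃ m : ℤ, e = s(m, m + 1)) :
    vset A.graph = ends (edgeIdx A) := by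
  ext v
  constructor
  · rintro ⟨e, he, hv⟩
    obtain ⟨m, rfl⟩ := hA e he
    rcases Sym2.mem_iff.mp hv with rfl | rfl
    · exact Or.inl he
    · exact Or.inr (by simpa [edgeIdx] using he)
  · rintro (h | h)
    · exact ⟨_, h, by simp⟩
    · exact ⟨_, h, by simp⟩

theorem vset_finite (F : Finset (Sym2 ℤ)) : (vset F).Finite := by
  have : vset F = ⋃ e ∈ F, (e.toFinset : Set ℤ) := by ext v; simp [vset]
  rw [this]
  exact F.finite_toSet.biUnion fun e _ => e.toFinset.finite_toSet

theorem numClosed_sub_le_delta {A : JoinTree ℤ}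
    (hA : ∀ e ∈ A.graph, ∃ m : ℤ, e = s(m, m + 1)) (S : Set ℤ) {c : ℝ} (hc : 0 ≤ c) :
    numClosed (edgeIdx A) S - (freeEdges (edgeIdx A) S).ncard * c ≤
      Delta (fun _ => 1 + c) (elimS A.graph S) := by
  set F := elimS A.graph S
  set J : Set ℤ := {m | s(m, m + 1) ∈ F}
  have hFA : F ⊆ A.graph := Finset.filter_subset _ _
  have hJA : J ⊆ edgeIdx A := fun m hm => hFA hm
  have hJf : J.Finite := (edgeIdx_finite A).subset hJA
  have hJcard : J.ncard = F.card := by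
    rw [← Set.ncard_image_of_injective J mk_succ_injective, ← Set.ncard_coe_finset]
    congr 1
    ext e
    constructor
    · rintro ⟨m, hm, rfl⟩
      exact hm
    · intro he
      obtain ⟨m, rfl⟩ := hA e (hFA he)
      exact ⟨m, he, rfl⟩
  have hfree : F.card ≤ (freeEdges (edgeIdx A) S).ncard := by
    rw [← hJcard]
    refine Set.ncard_le_ncard (fun m hm => ⟨hJA hm, ?_, ?_⟩)
      ((edgeIdx_finite A).subset (freeEdges_subset _ _))
    · exact fun h => (Finset.mem_filter.mp hm).2 m (by simp) m h (SimpleGraph.Reachable.refl _)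
    · exact fun h => (Finset.mem_filter.mp hm).2 (m + 1) (by simp) (m + 1) h
        (SimpleGraph.Reachable.refl _)
  have hright : ∀ z ∈ closedRuns (edgeIdx A) S, z.2 - 1 ∈ J := by
    rintro ⟨i, j⟩ hz
    have hij := hz.lt
    dsimp at hij ⊢
    refine Finset.mem_filter.mpr ⟨hz.mem _ (by dsimp; omega) (by dsimp; omega), ?_⟩
    intro v hv s hs hr
    have hv' : i ≤ v ∧ v ≤ j := by
      rcases Sym2.mem_iff.mp hv with rfl | rfl <;> omega
    obtain ⟨h1, h2⟩ := mem_of_reachable hA hr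
    refine hz.disj s ?_ ?_ hs <;> dsimp <;> by_contra hcon
    · exact hz.left (h2 (i - 1) (by omega) (by omega))
    · exact hz.right (h1 j (by omega) (by omega))
  have hinj : Set.InjOn Prod.snd (closedRuns (edgeIdx A) S) := by
    rintro ⟨i, j⟩ hz ⟨i', j'⟩ hz' h
    have h1 := hz.lt
    have h2 := hz'.lt
    dsimp at h h1 h2
    have := hz.eq hz' (e := j - 1) (by dsimp; omega) (by dsimp; omega) (by dsimp; omega)
      (by dsimp; omega)
    exact Prod.ext this.1 this.2
  have hvert : J.ncard + numClosed (edgeIdx A) S ≤ (vset F).ncard := by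
    rw [numClosed, ← hinj.ncard_image, ← Set.ncard_union_eq ?_ hJf
      ((closedRuns_finite (edgeIdx_finite A) S).image _)]
    · refine Set.ncard_le_ncard ?_ (vset_finite F)
      rintro v (hv | ⟨z, hz, rfl⟩)
      · exact ⟨_, hv, by simp⟩
      · exact ⟨_, hright z hz, by simp⟩
    · refine Set.disjoint_left.mpr ?_
      rintro _ h1 ⟨z, hz, rfl⟩
      exact hz.right (hJA h1)
  have h1 : (F.card + numClosed (edgeIdx A) S : ℝ) ≤ (vset F).ncard := by
    rw [hJcard] at hvert
    exact_mod_cast hvert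
  have h2 : (F.card : ℝ) * c ≤ (freeEdges (edgeIdx A) S).ncard * c :=
    mul_le_mul_of_nonneg_right (by exact_mod_cast hfree) hc
  simp only [Delta, Finset.sum_const, nsmul_eq_mul]
  linarith

theorem isUnitPotential_of_phi2Ok {P : Set (Sym2 ℤ)} (hP : ∀ e ∈ P, ∃ m : ℤ, e = s(m, m + 1))
    {c : ℝ} (hc : 0 ≤ c) {g : JoinTree ℤ → Set ℤ → ℝ} (hg : Phi2Ok P (fun _ => 1 + c) g) :
    IsUnitPotential P fun A S => g A S + (freeEdges (edgeIdx A) S).ncard * c := by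
  obtain ⟨-, hleaf, hd1, hd2, hi1, hi2, hh⟩ := hg
  have hE : ∀ {A}, Over P A → ∀ e ∈ A.graph, ∃ m : ℤ, e = s(m, m + 1) :=
    fun hA e he => hP e (hA he)
  have hadd : ∀ {A B C : JoinTree ℤ} (S : Set ℤ), Sub B A → Sub C A →
      (freeEdges (edgeIdx B) S).ncard * c +
        (freeEdges (edgeIdx C) (S ∪ ends (edgeIdx B))).ncard * c ≤
        (freeEdges (edgeIdx A) S).ncard * c := fun S hB hC => by
    rw [← add_mul]
    refine mul_le_mul_of_nonneg_right ?_ hc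
    exact_mod_cast ncard_freeEdges_add_le (edgeIdx_finite _) (edgeIdx_subset_of_sub hB)
      (edgeIdx_subset_of_sub hC)
  refine ⟨fun l S hl => ?_, fun A B C S hA h => ?_, fun A B C S hA h => ?_,
    fun A D S hA hD hS => ?_⟩
  · linarith [hleaf _ S hl ⟨l, rfl⟩, numClosed_sub_le_delta (hE hl) S hc]
  · have hBo := hA.of_sub h.sub
    have hCo := hA.of_sub h.symm.sub
    have h1 : g B S + Delta (fun _ => 1 + c) (elimS C.graph (S ∪ ends (edgeIdx B))) ≤ g A S := by
      rw [← vset_graph_eq (hE hBo)]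
      rcases h with rfl | rfl
      · exact hd1 B C S hA
      · exact hd2 C B S hA
    have h2 := numClosed_sub_le_delta (hE hCo) (S ∪ ends (edgeIdx B)) hc
    linarith [hadd S h.sub h.symm.sub]
  · have hBo := hA.of_sub h.sub
    have h1 : Delta (fun _ => 1 + c) (elimS B.graph S) + g C (S ∪ ends (edgeIdx B)) ≤ g A S := by
      rw [← vset_graph_eq (hE hBo)]
      rcases h with rfl | rfl
      · exact hi1 B C S hA
      · exact hi2 C B S hA
    have h2 := numClosed_sub_le_delta (hE hBo) S hc
    linarith [hadd S h.sub h.symm.sub]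
  · have hDo := hA.of_sub hD.1
    rw [← vset_graph_eq (hE hDo)] at hS
    have h1 := hh A D S hA hD hS
    rw [vset_graph_eq (hE hDo)] at h1
    have h2 := numClosed_sub_le_delta (hE hA) S hc
    linarith [hadd S hD.1 (Sub.refl A)]

theorem two_le_sizeOf (A : JoinTree ℤ) : 2 ≤ sizeOf A := by
  induction A with
  | leaf l => rcases l with _ | e <;> simp
  | node B C _ _ => rw [JoinTree.node.sizeOf_spec]; omega

theorem JoinTree.Sub.sizeOf_le {D A : JoinTree ℤ} (h : Sub D A) : sizeOf D ≤ sizeOf A := by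
  induction h with
  | empty A => simpa using two_le_sizeOf A
  | refl => exact le_rfl
  | left _ ih => rw [JoinTree.node.sizeOf_spec]; omega
  | right _ ih => rw [JoinTree.node.sizeOf_spec]; omega

theorem exists_phi2Ok (P : Finset (Sym2 ℤ)) {θ : Sym2 ℤ → ℝ} (hθ : ∀ e, 0 ≤ θ e) :
    ∃ g, Phi2Ok (P : Set (Sym2 ℤ)) θ g := by
  set N : ℝ := ((vset P).ncard : ℝ)
  have hN0 : 0 ≤ N := Nat.cast_nonneg _
  have hdelta : ∀ {A : JoinTree ℤ} (S : Set ℤ), Over (P : Set (Sym2 ℤ)) A →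
      Delta θ (elimS A.graph S) ≤ N := by
    intro A S hA
    have h1 : 0 ≤ ∑ e ∈ elimS A.graph S, θ e := Finset.sum_nonneg fun e _ => hθ e
    have h2 := Set.ncard_le_ncard
      (vset_mono ((Finset.filter_subset _ _).trans (Finset.coe_subset.mp hA)) :
        vset (elimS A.graph S) ⊆ vset P) (vset_finite P)
    have h3 : ((vset (elimS A.graph S)).ncard : ℝ) ≤ N := Nat.cast_le.mpr h2
    unfold Delta
    linarith
  have hmono : ∀ S T : Set ℤ, ((vset P \ (S ∪ T)).ncard : ℝ) ≤ (vset P \ S).ncard := fun S T => by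
    exact_mod_cast Set.ncard_le_ncard (Set.sdiff_subset_sdiff_right Set.subset_union_left)
      ((vset_finite P).sdiff)
  have hstep : ∀ {A B C : JoinTree ℤ} (S T : Set ℤ) (d : ℝ), Children A B C → d ≤ N →
      N * (sizeOf B + (vset P \ (S ∪ T)).ncard) + d ≤ N * (sizeOf A + (vset P \ S).ncard) := by
    intro A B C S T d h hd
    have h1 : (sizeOf B + 1 : ℝ) ≤ sizeOf A := by exact_mod_cast h.sizeOf_lt
    nlinarith [hmono S T]
  refine ⟨fun A S => N * (sizeOf A + (vset P \ S).ncard), fun A S _ => by positivity,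
    fun A S hA _ => ?_, fun B C S hA => ?_, fun B C S hA => ?_, fun B C S hA => ?_,
    fun B C S hA => ?_, fun A D S hA hD hS => ?_⟩
  · refine (hdelta S hA).trans (le_mul_of_one_le_right hN0 ?_)
    have h2 : (2 : ℝ) ≤ sizeOf A := by exact_mod_cast two_le_sizeOf A
    have h3 : (0 : ℝ) ≤ (vset P \ S).ncard := Nat.cast_nonneg _
    linarith
  · have h : Children (node B C) B C := Or.inl rfl
    simpa using hstep S ∅ _ h (hdelta _ (hA.of_sub h.symm.sub))
  · have h : Children (node B C) C B := Or.inr rfl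
    simpa using hstep S ∅ _ h (hdelta _ (hA.of_sub h.symm.sub))
  · have h : Children (node B C) C B := Or.inr rfl
    rw [add_comm]
    exact hstep S _ _ h (hdelta _ (hA.of_sub h.symm.sub))
  · have h : Children (node B C) B C := Or.inl rfl
    rw [add_comm]
    exact hstep S _ _ h (hdelta _ (hA.of_sub h.symm.sub))
  · have h1 : (sizeOf D : ℝ) ≤ sizeOf A := by exact_mod_cast hD.1.sizeOf_le
    have h2 : (vset P \ (S ∪ vset D.graph)).ncard < (vset P \ S).ncard := by
      obtain ⟨v, hv, hvS⟩ := Set.not_subset.mp hS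
      refine Set.ncard_lt_ncard ⟨Set.sdiff_subset_sdiff_right Set.subset_union_left, fun h => ?_⟩
        (vset_finite P).sdiff
      have hvP := vset_mono (Finset.coe_subset.mp (hA.of_sub hD.1)) hv
      exact (h ⟨hvP, hvS⟩).2 (Or.inr hv)
    have h3 : ((vset P \ (S ∪ vset D.graph)).ncard + 1 : ℝ) ≤ (vset P \ S).ncard := by
      exact_mod_cast h2
    have h4 := hdelta S hA
    have h5 := mul_le_mul_of_nonneg_left (add_le_add h1 h3) hN0
    linarith

theorem mem_PkF {k : ℕ} {e : Sym2 ℤ} :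
    e ∈ PkF k ↔ ∃ m : ℤ, 0 ≤ m ∧ m < k ∧ e = s(m, m + 1) := by
  simp only [PkF, Finset.mem_image, Finset.bind_def, Finset.pure_def, Finset.mem_sup,
    Finset.mem_range, Finset.mem_singleton]
  constructor
  · rintro ⟨_, ⟨i, hi, rfl⟩, rfl⟩
    exact ⟨i, by omega, by omega, rfl⟩
  · rintro ⟨m, h0, hm, rfl⟩
    lift m to ℕ using h0
    exact ⟨m, ⟨m, by omega, rfl⟩, rfl⟩

theorem edgeIdx_of_graph_eq {k : ℕ} {A : JoinTree ℤ} (hA : A.graph = PkF k) :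
    edgeIdx A = Set.Ico 0 (k : ℤ) := by
  ext m
  rw [edgeIdx, Set.mem_ofPred_eq, hA, mem_PkF]
  constructor
  · rintro ⟨m', h0, hm, h⟩
    rw [mk_succ_injective h]
    exact ⟨h0, hm⟩
  · rintro ⟨h0, hm⟩
    exact ⟨m, h0, hm, rfl⟩

theorem IsUnitPotential.logb_le {k : ℕ} (hk : 1 ≤ k) {f : JoinTree ℤ → Set ℤ → ℝ}
    (hf : IsUnitPotential (PkF k) f) {A : JoinTree ℤ} (hA : A.graph = PkF k) :
    Real.logb (√5 + 5) k ≤ f A ∅ := by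
  have h5 := sqrt_five_gt
  have h55 := sqrt_five_sq
  have hI := edgeIdx_of_graph_eq hA
  have hk' : (0 : ℝ) < k := by exact_mod_cast hk
  have hrun : IsClosedRun (edgeIdx A) ∅ 0 k := by
    rw [hI]
    exact ⟨by omega, fun m h1 h2 => ⟨h1, h2⟩, by simp, by simp, by simp⟩
  have h1 := hf.boundsSegments (A := A) (by rw [Over, hA]) _ _ _ hrun.isSegment
  rw [segWeight_closed (by simp) (by simp)] at h1
  have h2 : 1 ≤ numClosed (edgeIdx A) ∅ := Nat.one_le_iff_ne_zero.mpr
    (Set.ncard_ne_zero_of_mem (a := ((0 : ℤ), (k : ℤ))) hrun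
      (closedRuns_finite (edgeIdx_finite A) ∅))
  have h3 : (1 : ℝ) ≤ numClosed (edgeIdx A) ∅ := by exact_mod_cast h2
  rw [Real.logb_le_iff_le_rpow one_lt_base hk']
  have h4 : expExcess f A ∅ ≤ (√5 + 5) ^ (f A ∅ - 1) :=
    Real.rpow_le_rpow_of_exponent_le one_lt_base.le (by linarith)
  rw [Real.rpow_sub_one (by positivity), le_div_iff₀ (by positivity)] at h4
  push_cast at h1
  nlinarith

/-- Let `k ≥ 1` and let `θ ≡ 1 + 1/k` be the constant threshold
weighting on the path `P_k`. For every join-tree `A` over `P_k` whose graph equals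
`P_k`, `Φ_θ(A|∅) ≥ log_{√5+5}(k) − 1`. -/
theorem stmt16 (k : ℕ) (hk : 1 ≤ k) (A : JoinTree ℤ) (hA : A.graph = PkF k) :
    Real.logb (Real.sqrt 5 + 5) (k : ℝ) - 1
      ≤ Phi2 (↑(PkF k)) (fun _ => 1 + 1 / (k : ℝ)) A ∅ := by
  have hk' : (0 : ℝ) < k := by exact_mod_cast hk
  have hc : (0 : ℝ) ≤ 1 / k := by positivity
  obtain ⟨g₀, hg₀⟩ := exists_phi2Ok (PkF k) (θ := fun _ => 1 + 1 / (k : ℝ)) fun _ => by positivity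
  refine le_csInf ⟨_, g₀, hg₀, rfl⟩ ?_
  rintro _ ⟨g, hg, rfl⟩
  have hf := isUnitPotential_of_phi2Ok
    (fun e he => (mem_PkF.mp he).imp fun _ h => h.2.2) hc hg
  have h1 := hf.logb_le hk hA
  have h2 : (freeEdges (edgeIdx A) ∅).ncard ≤ k := by
    refine (Set.ncard_le_ncard (freeEdges_subset _ _) (edgeIdx_finite A)).trans ?_
    rw [edgeIdx_of_graph_eq hA, ← Finset.coe_Ico, Set.ncard_coe_finset, Int.card_Ico]
    simp
  have h3 : ((freeEdges (edgeIdx A) ∅).ncard : ℝ) * (1 / k) ≤ 1 := by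
    rw [mul_one_div, div_le_one hk']
    exact_mod_cast h2
  linarith

end Paper

end
end

section
/- There is an absolute constant C such that for every integer k ≥ 1 there exists a sequence a ∈ 𝒫(k) with χ(a) + ‖a‖ ≤ (1/3)·log_φ(k) + C, where φ = (√5 + 1)/2 is the golden ratio. -/
open scoped Classical

noncomputable section

namespace Paper

variable {V : Type*}

/-- `a ∈ 𝒫(k)`: the entries `a_0, …, a_k` lie in `[0,1]` and sum to at least `1`. -/
def InP (k : ℕ) (a : ℕ → ℝ) : Prop :=
  (∀ t ≤ k, 0 ≤ a t ∧ a t ≤ 1) ∧ 1 ≤ ∑ t ∈ Finset.range (k + 1), a t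

/-- The complexity measure `χ` on sequences `a ∈ 𝒫(k)`:
`χ(a_0, a_1) = 0`, and for `k ≥ 2`, `χ(a)` is the infimum of
`‖b − a‖ + max {χ(b_0,…,b_j), χ(b_i,…,b_k)}` over `0 < i ≤ j < k` and `b ∈ 𝒫(k)`
with `a ≤ b`, `(b_0,…,b_j) ∈ 𝒫(j)` and `(b_i,…,b_k) ∈ 𝒫(k−i)`. -/
def seqChi : ℕ → (ℕ → ℝ) → ℝ
  | 0, _ => 0
  | 1, _ => 0
  | k + 2, a => sInf { r | ∃ (i j : ℕ) (b : ℕ → ℝ),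
      0 < i ∧ i ≤ j ∧ j < k + 2 ∧
      (∀ t ≤ k + 2, a t ≤ b t) ∧ InP (k + 2) b ∧ InP j b ∧
      InP (k + 2 - i) (fun t => b (i + t)) ∧
      r = (∑ t ∈ Finset.range (k + 3), (b t - a t)) +
          max (if h : j < k + 2 then seqChi j b else 0)
              (if h : k + 2 - i < k + 2 then seqChi (k + 2 - i) (fun t => b (i + t)) else 0) }
  termination_by k _ => k
  decreasing_by
  · exact h
  · exact h

lemma seqChi_nonneg (k : ℕ) (a : ℕ → ℝ) : 0 ≤ seqChi k a := by
  induction k using Nat.strong_induction_on generalizing a with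
  | _ k ih =>
    match k, ih with
    | 0, _ => simp [seqChi]
    | 1, _ => simp [seqChi]
    | k + 2, ih =>
      rw [seqChi]
      refine Real.sInf_nonneg ?_
      rintro r ⟨i, j, b, _, _, hj, hab, _, _, _, rfl⟩
      refine add_nonneg (Finset.sum_nonneg fun t ht => ?_) (le_max_of_le_left ?_)
      · exact sub_nonneg.2 (hab t (by have := Finset.mem_range.1 ht; omega))
      · rw [dif_pos hj]
        exact ih j hj b

/-- Every admissible choice of `i`, `j`, `b` bounds `χ` from above. -/
lemma seqChi_le {k i j : ℕ} {a b : ℕ → ℝ} (hi : 0 < i) (hij : i ≤ j) (hj : j < k)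
    (hab : ∀ t ≤ k, a t ≤ b t) (hb : InP k b) (hbj : InP j b)
    (hbi : InP (k - i) (fun t => b (i + t))) :
    seqChi k a ≤ (∑ t ∈ Finset.range (k + 1), (b t - a t)) +
      max (seqChi j b) (seqChi (k - i) (fun t => b (i + t))) := by
  obtain ⟨k, rfl⟩ : ∃ m, k = m + 2 := ⟨k - 2, by omega⟩
  rw [seqChi]
  refine csInf_le ⟨0, ?_⟩ ⟨i, j, b, hi, hij, hj, hab, hb, hbj, hbi, ?_⟩
  · rintro r ⟨i, j, b, _, _, hj, hab, _, _, _, rfl⟩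
    refine add_nonneg (Finset.sum_nonneg fun t ht => ?_) (le_max_of_le_left ?_)
    · exact sub_nonneg.2 (hab t (by have := Finset.mem_range.1 ht; omega))
    · rw [dif_pos hj]
      exact seqChi_nonneg j b
  · rw [dif_pos hj, dif_pos (by omega)]

/-- On `0, …, p + q`, the sequence `a` equals `1/3` at `0`, `p`, `p + q` and vanishes elsewhere. -/
def IsThreePoint (p q : ℕ) (a : ℕ → ℝ) : Prop :=
  ∀ t ≤ p + q, a t = if t = 0 ∨ t = p ∨ t = p + q then 1 / 3 else 0

lemma IsThreePoint.sum_eq {p q : ℕ} {a : ℕ → ℝ} (h : IsThreePoint p q a)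
    (hp : 1 ≤ p) (hq : 1 ≤ q) : ∑ t ∈ Finset.range (p + q + 1), a t = 1 := by
  have key : ∀ t ∈ Finset.range (p + q + 1), a t =
      (if t = 0 then 1 / 3 else 0) + (if t = p then 1 / 3 else 0) +
        (if t = p + q then 1 / 3 else 0) := by
    intro t ht
    rw [h t (by have := Finset.mem_range.1 ht; omega)]
    split_ifs <;> first | omega | norm_num
  rw [Finset.sum_congr rfl key]
  simp only [Finset.sum_add_distrib, Finset.sum_ite_eq', Finset.mem_range]
  rw [if_pos (by omega), if_pos (by omega), if_pos (by omega)]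
  norm_num

lemma IsThreePoint.inP {p q : ℕ} {a : ℕ → ℝ} (h : IsThreePoint p q a)
    (hp : 1 ≤ p) (hq : 1 ≤ q) : InP (p + q) a := by
  refine ⟨fun t ht => ?_, (h.sum_eq hp hq).ge⟩
  rw [h t ht]
  split_ifs <;> norm_num

/-- Inserting a fourth point costs `1/3` and splits a three-point sequence into two
overlapping three-point sequences with gaps `(u, v)` and `(v, w)`. -/
lemma seqChi_le_of_split {u v w x : ℕ} {c : ℝ} (hu : 1 ≤ u) (hv : 1 ≤ v) (hw : 1 ≤ w)
    (hx : x = u ∨ x = u + v)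
    (h₁ : ∀ b, IsThreePoint u v b → seqChi (u + v) b ≤ c)
    (h₂ : ∀ b, IsThreePoint v w b → seqChi (v + w) b ≤ c)
    {a : ℕ → ℝ} (ha : ∀ t ≤ u + v + w, a t = if t = 0 ∨ t = x ∨ t = u + v + w then 1 / 3 else 0) :
    seqChi (u + v + w) a ≤ c + 1 / 3 := by
  obtain ⟨y, hy, hxy⟩ : ∃ y, y ≤ u + v ∧ ((x = u ∧ y = u + v) ∨ (x = u + v ∧ y = u)) := by
    rcases hx with h | h
    · exact ⟨u + v, le_rfl, .inl ⟨h, rfl⟩⟩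
    · exact ⟨u, by omega, .inr ⟨h, rfl⟩⟩
  set b : ℕ → ℝ := fun t =>
    if t = 0 ∨ t = u ∨ t = u + v ∨ t = u + v + w then 1 / 3 else 0 with hb
  have hdiff : ∀ t ≤ u + v + w, b t - a t = if t = y then 1 / 3 else 0 := by
    intro t ht
    rw [ha t ht, hb]
    dsimp only
    split_ifs <;> first | omega | norm_num
  have hab : ∀ t ≤ u + v + w, a t ≤ b t := by
    intro t ht
    have := hdiff t ht
    split_ifs at this <;> linarith
  have hleft : IsThreePoint u v b := by
    intro t ht
    simp only [hb]
    split_ifs <;> first | omega | norm_num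
  have hright : IsThreePoint v w (fun t => b (u + t)) := by
    intro t ht
    simp only [hb]
    split_ifs <;> first | omega | norm_num
  have hbP : InP (u + v + w) b := by
    refine ⟨fun t _ => ?_, (hleft.inP hu hv).2.trans ?_⟩
    · simp only [hb]
      split_ifs <;> norm_num
    · refine Finset.sum_le_sum_of_subset_of_nonneg
        (Finset.range_subset_range.2 (by omega)) fun t _ _ => ?_
      simp only [hb]
      split_ifs <;> norm_num
  have hk : u + v + w - u = v + w := by omega
  have hmain := seqChi_le (k := u + v + w) (i := u) (j := u + v) hu (by omega) (by omega) hab hbP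
    (hleft.inP hu hv) (by rw [hk]; exact hright.inP hv hw)
  rw [hk, Finset.sum_congr rfl fun t ht =>
    hdiff t (by have := Finset.mem_range.1 ht; omega), Finset.sum_ite_eq',
    if_pos (Finset.mem_range.2 (by omega))] at hmain
  linarith [max_le (h₁ b hleft) (h₂ _ hright)]

lemma seqChi_two_le {a : ℕ → ℝ} (ha : IsThreePoint 1 1 a) : seqChi 2 a ≤ 1 / 3 := by
  have h0 : a 0 = 1 / 3 := by simpa using ha 0 (by norm_num)
  have h1 : a 1 = 1 / 3 := by simpa using ha 1 (by norm_num)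
  have h2 : a 2 = 1 / 3 := by simpa using ha 2 (by norm_num)
  set b : ℕ → ℝ := fun t => if t = 1 then 2 / 3 else 1 / 3 with hb
  have hbound : ∀ t, 0 ≤ b t ∧ b t ≤ 1 := by
    intro t
    simp only [hb]
    split_ifs <;> norm_num
  have hmain := seqChi_le (k := 2) (i := 1) (j := 1) (a := a) (b := b) one_pos le_rfl one_lt_two
    (by intro t ht; interval_cases t <;> norm_num [hb, h0, h1, h2])
    ⟨fun t _ => hbound t, by norm_num [hb, Finset.sum_range_succ]⟩
    ⟨fun t _ => hbound t, by norm_num [hb, Finset.sum_range_succ]⟩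
    ⟨fun t _ => hbound _, by norm_num [hb, Finset.sum_range_succ]⟩
  have hone : ∀ f, seqChi 1 f = 0 := fun f => by rw [seqChi]
  refine hmain.trans ?_
  rw [show 2 - 1 = 1 from rfl, hone, hone]
  norm_num [hb, Finset.sum_range_succ, h0, h1, h2]

lemma seqChi_le_of_fib (n : ℕ) : ∀ p q : ℕ, 1 ≤ p → 1 ≤ q →
    (p ≤ Nat.fib (n + 1) ∧ q ≤ Nat.fib (n + 2) ∨ p ≤ Nat.fib (n + 2) ∧ q ≤ Nat.fib (n + 1)) →
    ∀ a, IsThreePoint p q a → seqChi (p + q) a ≤ ((n : ℝ) + 1) / 3 := by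
  induction n with
  | zero =>
    intro p q hp hq h a ha
    norm_num at h
    obtain rfl : p = 1 := by omega
    obtain rfl : q = 1 := by omega
    simpa using seqChi_two_le ha
  | succ n ih =>
    intro p q hp hq h a ha
    have hf : Nat.fib (n + 3) = Nat.fib (n + 1) + Nat.fib (n + 2) := Nat.fib_add_two
    have h1 : 1 ≤ Nat.fib (n + 1) := Nat.fib_pos.2 (by omega)
    have h2 : Nat.fib (n + 1) ≤ Nat.fib (n + 2) := Nat.fib_mono (by omega)
    have hcast : (((n + 1 : ℕ) : ℝ) + 1) / 3 = ((n : ℝ) + 1) / 3 + 1 / 3 := by push_cast; ring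
    rw [hcast]
    change p ≤ Nat.fib (n + 2) ∧ q ≤ Nat.fib (n + 3) ∨
      p ≤ Nat.fib (n + 3) ∧ q ≤ Nat.fib (n + 2) at h
    have splitRight : ∀ v w, q = v + w → 1 ≤ v → 1 ≤ w → p ≤ Nat.fib (n + 2) →
        v ≤ Nat.fib (n + 1) → w ≤ Nat.fib (n + 2) →
        seqChi (p + q) a ≤ ((n : ℝ) + 1) / 3 + 1 / 3 := by
      rintro v w rfl hv hw hpf hvf hwf
      rw [← add_assoc]
      exact seqChi_le_of_split hp hv hw (.inl rfl) (ih p v hp hv (.inr ⟨hpf, hvf⟩))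
        (ih v w hv hw (.inl ⟨hvf, hwf⟩)) fun t ht => by rw [ha t (by omega), ← add_assoc]
    have splitLeft : ∀ u v, p = u + v → 1 ≤ u → 1 ≤ v → q ≤ Nat.fib (n + 2) →
        u ≤ Nat.fib (n + 2) → v ≤ Nat.fib (n + 1) →
        seqChi (p + q) a ≤ ((n : ℝ) + 1) / 3 + 1 / 3 := by
      rintro u v rfl hu hv hqf huf hvf
      exact seqChi_le_of_split hu hv hq (.inr rfl) (ih u v hu hv (.inr ⟨huf, hvf⟩))
        (ih v q hv hq (.inl ⟨hvf, hqf⟩)) ha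
    by_cases hpq : p = 1 ∧ q = 1
    · obtain ⟨rfl, rfl⟩ := hpq
      have := seqChi_two_le ha
      have : (0 : ℝ) ≤ n := n.cast_nonneg
      change seqChi 2 a ≤ _
      linarith
    by_cases hq2 : 2 ≤ q ∧ p ≤ Nat.fib (n + 2)
    · have := min_le_left (Nat.fib (n + 1)) (q - 1)
      exact splitRight (min (Nat.fib (n + 1)) (q - 1)) (q - min (Nat.fib (n + 1)) (q - 1))
        (by omega) (by omega) (by omega) hq2.2 (by omega) (by omega)
    · exact splitLeft (p - min (Nat.fib (n + 1)) (p - 1)) (min (Nat.fib (n + 1)) (p - 1))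
        (by omega) (by omega) (by omega) (by omega) (by omega) (by omega)

lemma goldenRatio_pow_le_fib (n : ℕ) : Real.goldenRatio ^ n ≤ Nat.fib (n + 2) := by
  induction n using Nat.twoStepInduction with
  | zero => simp
  | one => simpa [Nat.fib_add_two] using Real.goldenRatio_lt_two.le
  | more n h₁ h₂ =>
    rw [Nat.fib_add_two (n := n + 2), pow_add, Real.goldenRatio_sq]
    push_cast
    calc Real.goldenRatio ^ n * (Real.goldenRatio + 1)
        = Real.goldenRatio ^ n + Real.goldenRatio ^ (n + 1) := by ring
      _ ≤ _ := add_le_add h₁ h₂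

/-- There is an absolute constant `C` such that for every `k ≥ 1`
there exists `a ∈ 𝒫(k)` with `χ(a) + ‖a‖ ≤ (1/3)·log_φ(k) + C`, where
`φ = (√5 + 1)/2` is the golden ratio. -/
theorem stmt17 : ∃ C : ℝ, ∀ k : ℕ, 1 ≤ k → ∃ a : ℕ → ℝ, InP k a ∧
    seqChi k a + ∑ t ∈ Finset.range (k + 1), a t
      ≤ (1 / 3) * Real.logb ((Real.sqrt 5 + 1) / 2) (k : ℝ) + C := by
  refine ⟨2, fun k hk => ?_⟩
  obtain rfl | hk2 : k = 1 ∨ 2 ≤ k := by omega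
  · refine ⟨fun t => if t = 0 then 1 else 0, ⟨fun t _ => ?_, ?_⟩, ?_⟩
    · dsimp only
      split_ifs <;> norm_num
    · norm_num [Finset.sum_range_succ]
    · norm_num [Finset.sum_range_succ, seqChi]
  obtain ⟨n, hn⟩ : ∃ n, Nat.greatestFib k = n + 2 := by
    have : 3 ≤ Nat.greatestFib k := Nat.le_greatestFib.2 hk2
    exact ⟨Nat.greatestFib k - 2, by omega⟩
  have hlow : Nat.fib (n + 2) ≤ k := hn ▸ Nat.fib_greatestFib_le k
  have hupp : k < Nat.fib (n + 3) := by
    have := Nat.lt_fib_greatestFib_add_one k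
    rwa [hn] at this
  have hf : Nat.fib (n + 3) = Nat.fib (n + 1) + Nat.fib (n + 2) := Nat.fib_add_two
  have h1 : 1 ≤ Nat.fib (n + 1) := Nat.fib_pos.2 (by omega)
  have h2 : 1 ≤ Nat.fib (n + 2) := Nat.fib_pos.2 (by omega)
  obtain ⟨p, q, rfl, hp, hq, hpf, hqf⟩ : ∃ p q, k = p + q ∧ 1 ≤ p ∧ 1 ≤ q ∧
      p ≤ Nat.fib (n + 1) ∧ q ≤ Nat.fib (n + 2) :=
    ⟨min (Nat.fib (n + 1)) (k - 1), k - min (Nat.fib (n + 1)) (k - 1),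
      by omega, by omega, by omega, by omega, by omega⟩
  have ha : IsThreePoint p q (fun t => if t = 0 ∨ t = p ∨ t = p + q then 1 / 3 else 0) :=
    fun t _ => rfl
  refine ⟨_, ha.inP hp hq, ?_⟩
  rw [ha.sum_eq hp hq]
  have hchi := seqChi_le_of_fib n p q hp hq (.inl ⟨hpf, hqf⟩) _ ha
  have hlog : (n : ℝ) ≤ Real.logb ((Real.sqrt 5 + 1) / 2) ((p + q : ℕ) : ℝ) := by
    rw [show (Real.sqrt 5 + 1) / 2 = Real.goldenRatio by rw [Real.goldenRatio, add_comm],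
      Real.le_logb_iff_rpow_le Real.one_lt_goldenRatio (by exact_mod_cast hk), Real.rpow_natCast]
    exact (goldenRatio_pow_le_fib n).trans (by exact_mod_cast hlow)
  linarith

end Paper

end
end
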